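/- Theorem (specialisation (x_1,x_2,x_3) = (z²,z,1); proves Kanade–Russell's Conjecture 3.1 at z = q). Let a,b be nonnegative integers. Then, as an identity of formal power series in q and z: Σ over pairs of partitions λ, μ ∈ 𝒫 of (1 − z² q^{λ_a+μ_b−1}) · ∏_{i≥1} z^{λ_i+μ_i} q^{λ_i²−λ_iμ_i+μ_i² − χ(i≤a)λ_i − χ(i≤b)μ_i} / [(q;q)_{λ_i−λ_{i+1}} (q;q)_{μ_i−μ_{i+1}}] = 1/((zq,zq,z²q;q)_∞) · (1−z^{a+1})(1−z^{b+1})(1−z^{a+b+2}) / ((1−z)(1−z)(1−z²)), where χ(P) = 1 if P holds and 0 otherwise, and the convention q^{λ_0} = q^{μ_0} := 0 is used (so the prefactor equals 1 when a = 0 or b = 0). -/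

import Mathlib

noncomputable section

namespace Stmt5

/-- `(a; q)_n`, the finite q-Pochhammer symbol. -/
def qPoch (a q : ℂ) (n : ℕ) : ℂ := ∏ j ∈ Finset.range n, (1 - a * q ^ j)

/-- `(a; q)_∞`. -/
def qPochInf (a q : ℂ) : ℂ := ∏' j : ℕ, (1 - a * q ^ j)

/-- Integer partitions `λ₁ ≥ λ₂ ≥ ⋯ ≥ 0` with finitely many nonzero parts;
`f i` is the part `λ_{i+1}`. -/
def Ptn : Type :=
  {f : ℕ → ℕ // (∀ i j : ℕ, i ≤ j → f j ≤ f i) ∧ ∃ N, ∀ i, N ≤ i → f i = 0}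

/-! ### Finite `q`-Pochhammer symbols -/

lemma qPoch_zero (a q : ℂ) : qPoch a q 0 = 1 := by simp [qPoch]

lemma qPoch_succ (a q : ℂ) (n : ℕ) : qPoch a q (n + 1) = qPoch a q n * (1 - a * q ^ n) := by
  simp [qPoch, Finset.prod_range_succ]

lemma qPoch_succ' (a q : ℂ) (n : ℕ) :
    qPoch a q (n + 1) = (1 - a) * qPoch (a * q) q n := by
  simp only [qPoch, Finset.prod_range_succ', pow_zero, mul_one]
  rw [mul_comm]
  congr 1
  exact Finset.prod_congr rfl fun j _ ↦ by ring

lemma qPoch_add (a q : ℂ) (m n : ℕ) :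
    qPoch a q (m + n) = qPoch a q m * qPoch (a * q ^ m) q n := by
  simp only [qPoch, Finset.prod_range_add]
  congr 1
  exact Finset.prod_congr rfl fun j _ ↦ by ring

lemma qPoch_ne_zero {a q : ℂ} (h : ∀ n : ℕ, 1 - a * q ^ n ≠ 0) (n : ℕ) : qPoch a q n ≠ 0 :=
  Finset.prod_ne_zero_iff.2 fun j _ ↦ h j

lemma one_sub_ne_zero_of_norm_lt {x : ℂ} (h : ‖x‖ < 1) : 1 - x ≠ 0 := by
  intro h0
  rw [sub_eq_zero] at h0
  rw [← h0] at h
  simp at h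

lemma norm_sq_lt_one {z : ℂ} (hz : ‖z‖ < 1) : ‖z ^ 2‖ < 1 := by
  rw [norm_pow]
  exact pow_lt_one₀ (norm_nonneg _) hz two_ne_zero

lemma one_sub_pow_succ_ne_zero {q : ℂ} (hq : ‖q‖ < 1) (n : ℕ) : 1 - q ^ (n + 1) ≠ 0 := by
  apply one_sub_ne_zero_of_norm_lt
  rw [norm_pow]
  exact pow_lt_one₀ (norm_nonneg _) hq (by simp)

lemma qPoch_self_ne_zero {q : ℂ} (hq : ‖q‖ < 1) (n : ℕ) : qPoch q q n ≠ 0 :=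
  qPoch_ne_zero (fun k ↦ by simpa [pow_succ'] using one_sub_pow_succ_ne_zero hq k) n

lemma qPoch_self_succ (q : ℂ) (n : ℕ) :
    qPoch q q (n + 1) = qPoch q q n * (1 - q ^ (n + 1)) := by
  rw [qPoch_succ, pow_succ']

/-- `1 / (q; q)_{n - k}`, understood as `0` when `k > n`. -/
def invPoch (q : ℂ) (n k : ℕ) : ℂ := if k ≤ n then (qPoch q q (n - k))⁻¹ else 0

lemma invPoch_of_lt {q : ℂ} {n k : ℕ} (h : n < k) : invPoch q n k = 0 := by
  simp [invPoch, h]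

lemma invPoch_of_le {q : ℂ} {n k : ℕ} (h : k ≤ n) : invPoch q n k = (qPoch q q (n - k))⁻¹ := by
  simp [invPoch, h]

lemma invPoch_zero (q : ℂ) (n : ℕ) : invPoch q n 0 = (qPoch q q n)⁻¹ := by simp [invPoch]

lemma invPoch_self (q : ℂ) (n : ℕ) : invPoch q n n = 1 := by simp [invPoch, qPoch]

lemma invPoch_succ_succ (q : ℂ) (n k : ℕ) : invPoch q (n + 1) (k + 1) = invPoch q n k := by
  simp [invPoch]

lemma invPoch_add_add (q : ℂ) (n k m : ℕ) : invPoch q (m + n) (m + k) = invPoch q n k := by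
  simp [invPoch, Nat.add_sub_add_left]

lemma one_sub_mul_invPoch {q : ℂ} (hq : ‖q‖ < 1) {n k : ℕ} (h : k ≤ n + 1) :
    (1 - q ^ (n + 1 - k)) * invPoch q (n + 1) k = invPoch q n k := by
  rcases Nat.lt_or_ge n k with h1 | h1
  · rw [show k = n + 1 by omega, invPoch_of_lt (Nat.lt_succ_self n)]; simp
  · rw [invPoch_of_le h, invPoch_of_le h1, show n + 1 - k = (n - k) + 1 by omega,
      qPoch_self_succ]
    have := qPoch_self_ne_zero hq (n - k)
    have := one_sub_pow_succ_ne_zero hq (n - k)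
    field_simp

lemma one_sub_mul_inv_qPoch {q : ℂ} (hq : ‖q‖ < 1) (n : ℕ) :
    (1 - q ^ (n + 1)) * (qPoch q q (n + 1))⁻¹ = (qPoch q q n)⁻¹ := by
  have := one_sub_mul_invPoch hq (Nat.zero_le (n + 1))
  simpa [invPoch_zero] using this

/-! ### Summations of `q`-Chu–Vandermonde type

The sequence `H` stands for a multiple of `1 / (w q; q)_k`; only its recurrence matters. -/

lemma sum_range_succ_shift (M : ℕ) (S t u : ℕ → ℂ) (c d : ℂ)
    (h0 : c * S 0 = d * t 0) (ht : t (M + 1) = 0)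
    (hs : ∀ k ≤ M, c * S (k + 1) = d * t (k + 1) + u k) :
    c * ∑ k ∈ Finset.range (M + 2), S k =
      d * ∑ k ∈ Finset.range (M + 1), t k + ∑ k ∈ Finset.range (M + 1), u k := by
  have h1 : ∑ k ∈ Finset.range (M + 1), t k = ∑ k ∈ Finset.range (M + 2), t k := by
    rw [Finset.sum_range_succ _ (M + 1), ht, add_zero]
  rw [h1, Finset.sum_range_succ' _ (M + 1), Finset.sum_range_succ' t (M + 1), mul_add, mul_add, h0,
    Finset.mul_sum, Finset.mul_sum, add_right_comm, ← Finset.sum_add_distrib]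
  congr 1
  exact Finset.sum_congr rfl fun k hk ↦ hs k (by simpa [Nat.lt_succ_iff] using hk)

lemma sum_pow_mul_invPoch {q : ℂ} (hq : ‖q‖ < 1) (M L : ℕ) (w : ℂ) (H : ℕ → ℂ)
    (hH : ∀ k, H k = (1 - w * q ^ (k + 1)) * H (k + 1)) :
    ∑ k ∈ Finset.range (M + 1),
        w ^ k * q ^ (k * k) * H k * (qPoch q q k)⁻¹ * invPoch q L k * invPoch q M k =
      qPoch (w * q ^ (L + 1)) q M * H M * (qPoch q q L)⁻¹ * (qPoch q q M)⁻¹ := by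
  induction M generalizing L w H with
  | zero => simp [invPoch_zero, qPoch_zero]
  | succ M ih =>
    have hM := one_sub_pow_succ_ne_zero hq M
    apply mul_left_cancel₀ hM
    rw [sum_range_succ_shift M _
      (fun k ↦ w ^ k * q ^ (k * k) * H k * (qPoch q q k)⁻¹ * invPoch q L k * invPoch q M k)
      (fun j ↦ w * q ^ (M + 1) * ((w * q) ^ j * q ^ (j * j) * H (j + 1) * (qPoch q q j)⁻¹ *
        invPoch q L (j + 1) * invPoch q M j)) _ 1]
    · rw [ih L w H hH, ← Finset.mul_sum]
      have key : ∑ j ∈ Finset.range (M + 1), (w * q) ^ j * q ^ (j * j) * H (j + 1) *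
          (qPoch q q j)⁻¹ * invPoch q L (j + 1) * invPoch q M j =
          (1 - q ^ L) * (qPoch (w * q ^ (L + 1)) q M * H (M + 1) * (qPoch q q L)⁻¹ *
            (qPoch q q M)⁻¹) := by
        cases L with
        | zero => simp [invPoch]
        | succ L =>
          simp only [invPoch_succ_succ]
          rw [ih L (w * q) (fun j ↦ H (j + 1)) (fun k ↦ by rw [hH (k + 1)]; ring),
            ← one_sub_mul_inv_qPoch hq L]
          ring_nf
      rw [key, hH M, qPoch_succ, ← one_sub_mul_inv_qPoch hq M]
      ring
    · have := one_sub_mul_invPoch hq (Nat.zero_le (M + 1))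
      simp only [Nat.sub_zero] at this
      simp only [← this]; ring
    · simp [invPoch_of_lt (Nat.lt_succ_self M)]
    · intro k hk
      have h1 := one_sub_mul_invPoch hq (Nat.succ_le_succ hk)
      have h2 : q ^ (M + 1 - (k + 1)) * q ^ (k + 1) = q ^ (M + 1) := by
        rw [← pow_add]; congr 1; omega
      simp only [← h1, ← invPoch_succ_succ q M k, ← one_sub_mul_inv_qPoch hq k]
      simp only [← h2]
      ring

lemma sum_pow_sub_mul_sub_mul_invPoch {q : ℂ} (hq : ‖q‖ < 1) (M L : ℕ) (w : ℂ) (H : ℕ → ℂ)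
    (hH : ∀ k, H k = (1 - w * q ^ (k + 1)) * H (k + 1)) :
    ∑ k ∈ Finset.range (M + 1),
        q ^ ((L - k) * (M - k)) * H k * (qPoch q q k)⁻¹ * invPoch q L k * invPoch q M k =
      qPoch (w * q ^ (L + 1)) q M * H M * (qPoch q q L)⁻¹ * (qPoch q q M)⁻¹ := by
  induction M generalizing L w H with
  | zero => simp [invPoch_zero, qPoch_zero]
  | succ M ih =>
    have hM := one_sub_pow_succ_ne_zero hq M
    apply mul_left_cancel₀ hM
    rw [sum_range_succ_shift M _
      (fun k ↦ q ^ ((L - k) * (M - k)) * H k * (qPoch q q k)⁻¹ * invPoch q L k * invPoch q M k)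
      (fun j ↦ q ^ ((L - (j + 1)) * (M - j)) * H (j + 1) * (qPoch q q j)⁻¹ *
        invPoch q L (j + 1) * invPoch q M j) _ (q ^ L)]
    · rw [ih L w H hH]
      have key : ∑ j ∈ Finset.range (M + 1), q ^ ((L - (j + 1)) * (M - j)) * H (j + 1) *
          (qPoch q q j)⁻¹ * invPoch q L (j + 1) * invPoch q M j =
          (1 - q ^ L) * (qPoch (w * q ^ (L + 1)) q M * H (M + 1) * (qPoch q q L)⁻¹ *
            (qPoch q q M)⁻¹) := by
        cases L with
        | zero => simp [invPoch]
        | succ L =>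
          simp only [invPoch_succ_succ, Nat.add_sub_add_right]
          rw [ih L (w * q) (fun j ↦ H (j + 1)) (fun k ↦ by rw [hH (k + 1)]; ring),
            ← one_sub_mul_inv_qPoch hq L]
          ring_nf
      rw [key, hH M, qPoch_succ, ← one_sub_mul_inv_qPoch hq M]
      ring
    · have := one_sub_mul_invPoch hq (Nat.zero_le (M + 1))
      simp only [Nat.sub_zero] at this
      simp only [← this, Nat.sub_zero, Nat.mul_add, pow_add, mul_one]; ring
    · simp [invPoch_of_lt (Nat.lt_succ_self M)]
    · intro k hk
      rcases Nat.lt_or_ge L (k + 1) with hL | hL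
      · simp [invPoch_of_lt hL]
      rcases Nat.lt_or_ge M (k + 1) with hM' | hM'
      · obtain rfl : k = M := by omega
        simp only [invPoch_of_lt hM', invPoch_self, ← one_sub_mul_inv_qPoch hq k, Nat.sub_self,
          Nat.mul_zero]
        ring
      have h1 : _ * invPoch q (M + 1) (k + 1) = _ := one_sub_mul_invPoch hq (Nat.succ_le_succ hk)
      have h2 : q ^ (M + 1 - (k + 1)) * q ^ (k + 1) = q ^ (M + 1) := by
        rw [← pow_add]; congr 1; omega
      have h3 : q ^ L * q ^ ((L - (k + 1)) * (M - (k + 1))) =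
          q ^ (k + 1) * q ^ ((L - (k + 1)) * (M - k)) := by
        rw [← pow_add, ← pow_add, show M - k = M - (k + 1) + 1 by omega, Nat.mul_add]
        congr 1; omega
      simp only [← mul_assoc, h3]
      simp only [← h1, ← invPoch_succ_succ q M k, ← one_sub_mul_inv_qPoch hq k,
        Nat.add_sub_add_right] at h2 ⊢
      simp only [← h2]
      ring

lemma sum_pow_sq_mul_invPoch {q : ℂ} (hq : ‖q‖ < 1) (L : ℕ) (x : ℂ) (A : ℕ → ℂ)
    (hA : ∀ k, A k = (1 - x * q ^ (k + 1)) * A (k + 1)) :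
    ∑ k ∈ Finset.range (L + 1), x ^ k * q ^ (k * k) * A k * (qPoch q q k)⁻¹ * invPoch q L k =
      A L * (qPoch q q L)⁻¹ := by
  induction L generalizing x A with
  | zero => simp [invPoch_zero, qPoch_zero]
  | succ M ih =>
    have hM := one_sub_pow_succ_ne_zero hq M
    apply mul_left_cancel₀ hM
    rw [sum_range_succ_shift M _
      (fun k ↦ x ^ k * q ^ (k * k) * A k * (qPoch q q k)⁻¹ * invPoch q M k)
      (fun j ↦ x * q ^ (M + 1) * ((x * q) ^ j * q ^ (j * j) * A (j + 1) * (qPoch q q j)⁻¹ *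
        invPoch q M j)) _ 1]
    · rw [ih x A hA, ← Finset.mul_sum,
        ih (x * q) (fun j ↦ A (j + 1)) (fun k ↦ by rw [hA (k + 1)]; ring),
        hA M, ← one_sub_mul_inv_qPoch hq M]
      ring
    · have := one_sub_mul_invPoch hq (Nat.zero_le (M + 1))
      simp only [Nat.sub_zero] at this
      simp only [← this]; ring
    · simp [invPoch_of_lt (Nat.lt_succ_self M)]
    · intro k hk
      have h1 := one_sub_mul_invPoch hq (Nat.succ_le_succ hk)
      have h2 : q ^ (M + 1 - (k + 1)) * q ^ (k + 1) = q ^ (M + 1) := by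
        rw [← pow_add]; congr 1; omega
      simp only [← h1, ← invPoch_succ_succ q M k, ← one_sub_mul_inv_qPoch hq k]
      simp only [← h2]
      ring

lemma sum_pow_mul_invPoch_mul_invPoch {q : ℂ} (hq : ‖q‖ < 1) (L k : ℕ) (x : ℂ) (A : ℕ → ℂ)
    (hA : ∀ k, A k = (1 - x * q ^ (k + 1)) * A (k + 1)) :
    ∑ r ∈ Finset.range (L + 1), x ^ r * q ^ (r * (r - k)) * A r * invPoch q r k * invPoch q L r =
      x ^ k * A L * invPoch q L k := by
  rcases Nat.lt_or_ge L k with h | h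
  · rw [invPoch_of_lt h, mul_zero]
    refine Finset.sum_eq_zero fun r hr ↦ ?_
    rw [Finset.mem_range] at hr
    rw [invPoch_of_lt (show r < k by omega)]; ring
  obtain ⟨L, rfl⟩ := Nat.exists_eq_add_of_le h
  rw [add_assoc, Finset.sum_range_add, Finset.sum_eq_zero, zero_add]
  · have := sum_pow_sq_mul_invPoch hq L (x * q ^ k) (fun t ↦ A (k + t))
      (fun t ↦ by rw [hA (k + t)]; ring_nf)
    rw [invPoch_of_le h, Nat.add_sub_cancel_left, mul_assoc, ← this, Finset.mul_sum]
    refine Finset.sum_congr rfl fun t _ ↦ ?_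
    rw [invPoch_add_add, Nat.add_sub_cancel_left, invPoch_of_le (Nat.le_add_right k t),
      Nat.add_sub_cancel_left]
    ring
  · intro r hr
    rw [Finset.mem_range] at hr
    rw [invPoch_of_lt hr]; ring

/-! ### The `A₂` Bailey operator -/

/-- The `A₂` Bailey operator with parameters `x`, `y`, acting on functions of two naturals. -/
def baileyOp (q x y : ℂ) (f : ℕ → ℕ → ℂ) (L M : ℕ) : ℂ :=
  ∑ r ∈ Finset.range (L + 1), ∑ s ∈ Finset.range (M + 1),
    invPoch q L r * invPoch q M s * (x ^ r * y ^ s *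
      q ^ ((r : ℤ) ^ 2 - (r : ℤ) * (s : ℤ) + (s : ℤ) ^ 2)) * f r s

/-- The fixed point of the `A₂` Bailey operator. -/
def baileyFix (q u v : ℂ) (L M : ℕ) : ℂ :=
  qPoch (u * v * q) q (L + M) *
    ((qPoch q q L)⁻¹ * (qPoch (u * q) q L)⁻¹ * (qPoch (u * v * q) q L)⁻¹ *
      ((qPoch q q M)⁻¹ * (qPoch (v * q) q M)⁻¹ * (qPoch (u * v * q) q M)⁻¹))

lemma inv_qPoch_rec {q x : ℂ} (h : ∀ n : ℕ, 1 - x * q ^ (n + 1) ≠ 0) (k : ℕ) :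
    (qPoch (x * q) q k)⁻¹ = (1 - x * q ^ (k + 1)) * (qPoch (x * q) q (k + 1))⁻¹ := by
  have h1 : ∀ n : ℕ, 1 - x * q * q ^ n ≠ 0 := fun n ↦ by
    simpa [pow_succ', mul_assoc] using h n
  have := qPoch_ne_zero h1 k
  have h2 := h k
  rw [qPoch_succ, mul_assoc x, ← pow_succ']
  field_simp

lemma baileyOp_baileyFix {q u v : ℂ} (hq : ‖q‖ < 1) (hq0 : q ≠ 0)
    (hu : ∀ n : ℕ, 1 - u * q ^ (n + 1) ≠ 0) (hv : ∀ n : ℕ, 1 - v * q ^ (n + 1) ≠ 0)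
    (huv : ∀ n : ℕ, 1 - u * v * q ^ (n + 1) ≠ 0) :
    baileyOp q u v (baileyFix q u v) = baileyFix q u v := by
  set A : ℕ → ℂ := fun k ↦ (qPoch (u * q) q k)⁻¹ with hA
  set B : ℕ → ℂ := fun k ↦ (qPoch (v * q) q k)⁻¹ with hB
  set H : ℕ → ℂ := fun k ↦ (qPoch (u * v * q) q k)⁻¹ with hH
  have hfix : ∀ L M, baileyFix q u v L M = A L * B M *
      (qPoch (u * v * q ^ (L + 1)) q M * H M * (qPoch q q L)⁻¹ * (qPoch q q M)⁻¹) := by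
    intro L M
    have h1 : qPoch (u * v * q) q L ≠ 0 :=
      qPoch_ne_zero (fun n ↦ by simpa [pow_succ', mul_assoc] using huv n) L
    rw [baileyFix, qPoch_add, pow_succ', ← mul_assoc]
    simp only [hA, hB, hH]
    field_simp
  funext L M
  rw [hfix, ← sum_pow_mul_invPoch hq M L (u * v) H (inv_qPoch_rec huv), Finset.mul_sum]
  have h2 : ∀ k, A L * B M * ((u * v) ^ k * q ^ (k * k) * H k * (qPoch q q k)⁻¹ *
      invPoch q L k * invPoch q M k) = q ^ (k * k) * H k * (qPoch q q k)⁻¹ *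
        ((u ^ k * A L * invPoch q L k) * (v ^ k * B M * invPoch q M k)) := fun k ↦ by
    rw [mul_pow]; ring
  simp only [h2, ← sum_pow_mul_invPoch_mul_invPoch hq L _ u A (inv_qPoch_rec hu),
    ← sum_pow_mul_invPoch_mul_invPoch hq M _ v B (inv_qPoch_rec hv)]
  simp only [Finset.sum_mul_sum]
  simp only [Finset.mul_sum]
  rw [Finset.sum_comm, baileyOp]
  refine Finset.sum_congr rfl fun r hr ↦ ?_
  rw [Finset.sum_comm]
  refine Finset.sum_congr rfl fun s hs ↦ ?_
  rw [hfix, ← sum_pow_sub_mul_sub_mul_invPoch hq s r (u * v) H (inv_qPoch_rec huv)]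
  have h3 : ∑ k ∈ Finset.range (s + 1),
        q ^ ((r - k) * (s - k)) * H k * (qPoch q q k)⁻¹ * invPoch q r k * invPoch q s k =
      ∑ k ∈ Finset.range (M + 1),
        q ^ ((r - k) * (s - k)) * H k * (qPoch q q k)⁻¹ * invPoch q r k * invPoch q s k := by
    refine Finset.sum_subset ?_ fun k _ hk ↦ ?_
    · exact Finset.range_mono (Finset.mem_range.1 hs)
    · rw [Finset.mem_range, not_lt] at hk
      rw [invPoch_of_lt (show s < k from hk), mul_zero]
  rw [h3, Finset.mul_sum, Finset.mul_sum]
  refine Finset.sum_congr rfl fun k _ ↦ ?_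
  rcases Nat.lt_or_ge r k with hr | hr
  · simp [invPoch_of_lt hr]
  rcases Nat.lt_or_ge s k with hs | hs
  · simp [invPoch_of_lt hs]
  have h4 : q ^ ((r : ℤ) ^ 2 - (r : ℤ) * (s : ℤ) + (s : ℤ) ^ 2) * q ^ ((r - k) * (s - k)) =
      q ^ (k * k) * q ^ (r * (r - k)) * q ^ (s * (s - k)) := by
    simp only [← zpow_natCast, ← zpow_add₀ hq0]
    push_cast [hr, hs]
    congr 1; ring
  linear_combination (invPoch q L r * invPoch q M s * u ^ r * v ^ s * A r * B s * H k *
    (qPoch q q k)⁻¹ * invPoch q r k * invPoch q s k) * h4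

lemma baileyOp_add (q x y : ℂ) (f g : ℕ → ℕ → ℂ) :
    baileyOp q x y (f + g) = baileyOp q x y f + baileyOp q x y g := by
  funext L M
  simp only [baileyOp, Pi.add_apply, mul_add, Finset.sum_add_distrib]

lemma baileyOp_smul (q x y c : ℂ) (f : ℕ → ℕ → ℂ) :
    baileyOp q x y (c • f) = c • baileyOp q x y f := by
  funext L M
  simp only [baileyOp, Pi.smul_apply, smul_eq_mul, Finset.mul_sum]
  exact Finset.sum_congr rfl fun r _ ↦ Finset.sum_congr rfl fun s _ ↦ by ring

lemma baileyOp_swap {q : ℂ} (x y : ℂ) (f : ℕ → ℕ → ℂ) (L M : ℕ) :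
    baileyOp q x y f L M = baileyOp q y x (fun r s ↦ f s r) M L := by
  rw [baileyOp, baileyOp, Finset.sum_comm]
  refine Finset.sum_congr rfl fun r _ ↦ Finset.sum_congr rfl fun s _ ↦ ?_
  rw [show (s : ℤ) ^ 2 - (s : ℤ) * (r : ℤ) + (r : ℤ) ^ 2 =
    (r : ℤ) ^ 2 - (r : ℤ) * (s : ℤ) + (s : ℤ) ^ 2 by ring]
  ring

/-- Shift of the first argument, extended by zero. -/
def shiftL (f : ℕ → ℕ → ℂ) : ℕ → ℕ → ℂ
  | 0, _ => 0
  | L + 1, M => f L M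

/-- Shift of the second argument, extended by zero. -/
def shiftR (f : ℕ → ℕ → ℂ) (L M : ℕ) : ℂ := shiftL (fun r s ↦ f s r) M L

@[simp] lemma shiftL_zero (f : ℕ → ℕ → ℂ) (M : ℕ) : shiftL f 0 M = 0 := rfl
@[simp] lemma shiftL_succ (f : ℕ → ℕ → ℂ) (L M : ℕ) : shiftL f (L + 1) M = f L M := rfl
@[simp] lemma shiftR_zero (f : ℕ → ℕ → ℂ) (L : ℕ) : shiftR f L 0 = 0 := rfl
@[simp] lemma shiftR_succ (f : ℕ → ℕ → ℂ) (L M : ℕ) : shiftR f L (M + 1) = f L M := rfl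

lemma shiftL_smul (c : ℂ) (f : ℕ → ℕ → ℂ) : shiftL (c • f) = c • shiftL f := by
  funext L M; cases L <;> simp

lemma shiftR_smul (c : ℂ) (f : ℕ → ℕ → ℂ) : shiftR (c • f) = c • shiftR f := by
  funext L M; cases M <;> simp

lemma shiftL_add (f g : ℕ → ℕ → ℂ) : shiftL (f + g) = shiftL f + shiftL g := by
  funext L M; cases L <;> simp

lemma shiftR_add (f g : ℕ → ℕ → ℂ) : shiftR (f + g) = shiftR f + shiftR g := by
  funext L M; cases M <;> simp

lemma baileyOp_shiftL {q : ℂ} (hq0 : q ≠ 0) (x y : ℂ) (f : ℕ → ℕ → ℂ) :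
    baileyOp q x y (shiftL f) = (x * q) • shiftL (baileyOp q (x * q ^ 2) (y * q⁻¹) f) := by
  funext L M
  cases L with
  | zero => simp [baileyOp]
  | succ L =>
    simp only [baileyOp, Pi.smul_apply, smul_eq_mul, shiftL_succ]
    rw [Finset.sum_range_succ']
    simp only [shiftL_zero, shiftL_succ, mul_zero, Finset.sum_const_zero, add_zero, Finset.mul_sum,
      invPoch_succ_succ]
    refine Finset.sum_congr rfl fun r _ ↦ Finset.sum_congr rfl fun s _ ↦ ?_
    have h : q ^ (((r + 1 : ℕ) : ℤ) ^ 2 - ((r + 1 : ℕ) : ℤ) * (s : ℤ) + (s : ℤ) ^ 2) =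
        q * (q ^ 2) ^ r * (q⁻¹) ^ s * q ^ ((r : ℤ) ^ 2 - (r : ℤ) * (s : ℤ) + (s : ℤ) ^ 2) := by
      rw [← zpow_natCast (q ^ 2), ← zpow_natCast q⁻¹, inv_zpow', ← zpow_natCast q 2, ← zpow_mul,
        ← zpow_one_add₀ hq0, ← zpow_add₀ hq0, ← zpow_add₀ hq0]
      congr 1; push_cast; ring
    rw [h]; ring

lemma baileyOp_shiftR {q : ℂ} (hq0 : q ≠ 0) (x y : ℂ) (f : ℕ → ℕ → ℂ) :
    baileyOp q x y (shiftR f) = (y * q) • shiftR (baileyOp q (x * q⁻¹) (y * q ^ 2) f) := by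
  funext L M
  rw [baileyOp_swap]
  have := congrFun (congrFun (baileyOp_shiftL hq0 y x (fun r s ↦ f s r)) M) L
  simp only [Pi.smul_apply] at this ⊢
  refine this.trans ?_
  congr 1
  cases M with
  | zero => rfl
  | succ M => simp [baileyOp_swap (x * q⁻¹)]

lemma baileyFix_swap (q u v : ℂ) (L M : ℕ) : baileyFix q u v L M = baileyFix q v u M L := by
  simp only [baileyFix, mul_comm u v, add_comm L M]; ring

lemma qPoch_mul_base {a q : ℂ} (h : 1 - a ≠ 0) (n : ℕ) :
    qPoch (a * q) q n = qPoch a q n * (1 - a * q ^ n) / (1 - a) := by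
  rw [eq_div_iff h, ← qPoch_succ, qPoch_succ', mul_comm]

lemma baileyFix_expand_right {q u v : ℂ} (hq : ‖q‖ < 1) (hq0 : q ≠ 0)
    (hu : ∀ n : ℕ, 1 - u * q ^ n ≠ 0) (hv : ∀ n : ℕ, 1 - v * q ^ n ≠ 0)
    (huv : ∀ n : ℕ, 1 - u * v * q ^ n ≠ 0) :
    baileyFix q u v = baileyFix q u (v * q⁻¹)
      + (-v / ((1 - v) * (1 - v * q))) • shiftR (baileyFix q (u * q⁻¹) (v * q))
      + (u ^ 2 * v / ((1 - u) * (1 - u * q) * (1 - u * v) * (1 - u * v * q))) •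
        shiftL (shiftR (baileyFix q (u * q) v)) := by
  funext L M
  have hu0 : 1 - u ≠ 0 := by simpa using hu 0
  have hu1 : 1 - u * q ≠ 0 := by simpa using hu 1
  have hv0 : 1 - v ≠ 0 := by simpa using hv 0
  have hv1 : 1 - v * q ≠ 0 := by simpa using hv 1
  have hw0 : 1 - u * v ≠ 0 := by simpa using huv 0
  have hw1 : 1 - u * v * q ≠ 0 := by simpa using huv 1
  have e1 : v * q⁻¹ * q = v := by field_simp
  have e2 : u * (v * q⁻¹) * q = u * v := by field_simp
  have e3 : u * q⁻¹ * q = u := by field_simp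
  have e4 : u * q⁻¹ * (v * q) * q = u * v * q := by field_simp
  have e5 : u * q * v * q = u * v * q * q := by ring
  have A : ∀ n, qPoch (u * q) q n = qPoch u q n * (1 - u * q ^ n) / (1 - u) := qPoch_mul_base hu0
  have A2 : ∀ n, qPoch (u * q * q) q n =
      qPoch u q n * (1 - u * q ^ n) / (1 - u) * (1 - u * q ^ n * q) / (1 - u * q) := fun n ↦ by
    rw [qPoch_mul_base hu1, A]; ring
  have B : ∀ n, qPoch (v * q) q n = qPoch v q n * (1 - v * q ^ n) / (1 - v) := qPoch_mul_base hv0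
  have B2 : ∀ n, qPoch (v * q * q) q n =
      qPoch v q n * (1 - v * q ^ n) / (1 - v) * (1 - v * q ^ n * q) / (1 - v * q) := fun n ↦ by
    rw [qPoch_mul_base hv1, B]; ring
  have C : ∀ n, qPoch (u * v * q) q n = qPoch (u * v) q n * (1 - u * v * q ^ n) / (1 - u * v) :=
    qPoch_mul_base hw0
  have C2 : ∀ n, qPoch (u * v * q * q) q n = qPoch (u * v) q n * (1 - u * v * q ^ n) / (1 - u * v)
      * (1 - u * v * q ^ n * q) / (1 - u * v * q) := fun n ↦ by
    rw [qPoch_mul_base hw1, C]; ring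
  have a0 := qPoch_ne_zero hu
  have b0 := qPoch_ne_zero hv
  have c0 := qPoch_ne_zero huv
  have d0 := qPoch_self_ne_zero hq
  have d1 := one_sub_pow_succ_ne_zero hq
  simp only [Pi.add_apply, Pi.smul_apply, smul_eq_mul]
  cases L with
  | zero =>
    cases M with
    | zero => simp [baileyFix, qPoch_zero]
    | succ M =>
      simp only [baileyFix, e1, e2, e3, e4, shiftR_succ, shiftL_zero, B, B2, C,
        qPoch_zero, zero_add, mul_zero, add_zero, inv_one, one_mul, qPoch_succ v,
        qPoch_succ (u * v), qPoch_self_succ]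
      have := a0 M; have := b0 M; have := c0 M; have := d0 M; have := d1 M
      have := hv M; have := hv (M + 1); have := huv M; have := huv (M + 1)
      rw [pow_succ, ← mul_assoc] at *
      field_simp
      ring
  | succ L =>
    cases M with
    | zero =>
      simp only [baileyFix, e1, e2, shiftR_zero, shiftL_succ, A, C,
        qPoch_zero, add_zero, mul_zero, inv_one, mul_one]
      have := a0 (L + 1); have := c0 (L + 1)
      have := hu (L + 1); have := huv (L + 1)
      field_simp
    | succ M =>
      have i1 : L + 1 + (M + 1) = L + M + 1 + 1 := by ring
      have i2 : L + 1 + M = L + M + 1 := by ring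
      simp only [baileyFix, e1, e2, e3, e4, e5, shiftR_succ, shiftL_succ, A, A2, B, B2, C, C2,
        i1, i2, qPoch_succ u, qPoch_succ v, qPoch_succ (u * v), qPoch_self_succ]
      have := a0 L; have := c0 L; have := d0 L; have := d1 L
      have := b0 M; have := c0 M; have := d0 M; have := d1 M
      have := hu L; have := hu (L + 1); have := huv L; have := huv (L + 1)
      have := hv M; have := hv (M + 1); have := huv M; have := huv (M + 1)
      generalize qPoch (u * v) q (L + M) = W
      simp only [pow_succ, pow_add, ← mul_assoc] at *
      generalize q ^ L = X at *
      generalize q ^ M = Y at *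
      field_simp
      ring

lemma baileyFix_expand_left {q u v : ℂ} (hq : ‖q‖ < 1) (hq0 : q ≠ 0)
    (hu : ∀ n : ℕ, 1 - u * q ^ n ≠ 0) (hv : ∀ n : ℕ, 1 - v * q ^ n ≠ 0)
    (huv : ∀ n : ℕ, 1 - u * v * q ^ n ≠ 0) :
    baileyFix q u v = baileyFix q (u * q⁻¹) v
      + (-u / ((1 - u) * (1 - u * q))) • shiftL (baileyFix q (u * q) (v * q⁻¹))
      + (v ^ 2 * u / ((1 - v) * (1 - v * q) * (1 - u * v) * (1 - u * v * q))) •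
        shiftL (shiftR (baileyFix q u (v * q))) := by
  funext L M
  have h := congrFun (congrFun (baileyFix_expand_right hq hq0 hv hu
    (fun n ↦ by rw [mul_comm v]; exact huv n)) M) L
  simp only [Pi.add_apply, Pi.smul_apply, smul_eq_mul] at h ⊢
  rw [baileyFix_swap, h, baileyFix_swap q v, mul_comm v u]
  congr 2
  · cases L with
    | zero => simp
    | succ L => simp [baileyFix_swap q (v * q⁻¹)]
  · cases L with
    | zero => cases M <;> simp
    | succ L => cases M with
      | zero => simp
      | succ M => simp [baileyFix_swap q (v * q)]

lemma baileyOp_shiftL_eigen {q x y x' y' c c' : ℂ} (hq0 : q ≠ 0) {f : ℕ → ℕ → ℂ}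
    (h : baileyOp q x' y' f = c • f) (hx : x * q ^ 2 = x') (hy : y * q⁻¹ = y')
    (hc : x * q * c = c') : baileyOp q x y (shiftL f) = c' • shiftL f := by
  rw [baileyOp_shiftL hq0, hx, hy, h, shiftL_smul, smul_smul, hc]

lemma baileyOp_shiftR_eigen {q x y x' y' c c' : ℂ} (hq0 : q ≠ 0) {f : ℕ → ℕ → ℂ}
    (h : baileyOp q x' y' f = c • f) (hx : x * q⁻¹ = x') (hy : y * q ^ 2 = y')
    (hc : y * q * c = c') : baileyOp q x y (shiftR f) = c' • shiftR f := by
  rw [baileyOp_shiftR hq0, hx, hy, h, shiftR_smul, smul_smul, hc]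

lemma baileyOp_iterate_add (q x y : ℂ) (f g : ℕ → ℕ → ℂ) (n : ℕ) :
    (baileyOp q x y)^[n] (f + g) = (baileyOp q x y)^[n] f + (baileyOp q x y)^[n] g := by
  induction n generalizing f g with
  | zero => rfl
  | succ n ih => simp only [Function.iterate_succ_apply, baileyOp_add, ih]

lemma baileyOp_iterate_smul (q x y c : ℂ) (f : ℕ → ℕ → ℂ) (n : ℕ) :
    (baileyOp q x y)^[n] (c • f) = c • (baileyOp q x y)^[n] f := by
  induction n generalizing f with
  | zero => rfl
  | succ n ih => simp only [Function.iterate_succ_apply, baileyOp_smul, ih]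

lemma baileyOp_iterate_eigen {q x y c : ℂ} {f : ℕ → ℕ → ℂ} (h : baileyOp q x y f = c • f)
    (n : ℕ) : (baileyOp q x y)^[n] f = c ^ n • f := by
  induction n with
  | zero => simp
  | succ n ih => rw [Function.iterate_succ_apply, h, baileyOp_iterate_smul, ih, smul_smul,
      pow_succ']

/-! ### Infinite products and limits -/

open Filter Topology

lemma summable_norm_mul_pow {q : ℂ} (hq : ‖q‖ < 1) (a : ℂ) :
    Summable fun j : ℕ ↦ ‖-(a * q ^ j)‖ := by
  simp only [norm_neg, norm_mul, norm_pow]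
  exact (summable_geometric_of_lt_one (norm_nonneg _) hq).mul_left _

lemma multipliable_one_sub_mul_pow {q : ℂ} (hq : ‖q‖ < 1) (a : ℂ) :
    Multipliable fun j : ℕ ↦ 1 - a * q ^ j := by
  simpa only [← sub_eq_add_neg] using multipliable_one_add_of_summable (summable_norm_mul_pow hq a)

lemma tendsto_qPoch {q : ℂ} (hq : ‖q‖ < 1) (a : ℂ) :
    Tendsto (qPoch a q) atTop (𝓝 (qPochInf a q)) :=
  (multipliable_one_sub_mul_pow hq a).hasProd.tendsto_prod_nat

lemma qPochInf_ne_zero {q a : ℂ} (hq : ‖q‖ < 1) (h : ∀ n : ℕ, 1 - a * q ^ n ≠ 0) :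
    qPochInf a q ≠ 0 := by
  have := tprod_one_add_ne_zero_of_summable (f := fun j : ℕ ↦ -(a * q ^ j))
    (fun i ↦ by rw [← sub_eq_add_neg]; exact h i) (summable_norm_mul_pow hq a)
  simp only [← sub_eq_add_neg] at this
  exact this

lemma qPochInf_self_ne_zero {q : ℂ} (hq : ‖q‖ < 1) : qPochInf q q ≠ 0 :=
  qPochInf_ne_zero hq fun n ↦ by simpa [pow_succ'] using one_sub_pow_succ_ne_zero hq n

lemma qPochInf_eq_mul {q : ℂ} (hq : ‖q‖ < 1) (a : ℂ) :
    qPochInf a q = (1 - a) * qPochInf (a * q) q := by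
  refine tendsto_nhds_unique ((tendsto_qPoch hq a).comp (tendsto_add_atTop_nat 1)) ?_
  refine ((tendsto_qPoch hq (a * q)).const_mul (1 - a)).congr fun n ↦ ?_
  rw [Function.comp_apply, qPoch_succ']

lemma continuous_qPochInf {q : ℂ} (hq : ‖q‖ < 1) : Continuous fun a ↦ qPochInf a q := by
  rw [continuous_iff_continuousAt]
  intro a
  have h := Summable.hasProdUniformlyOn_nat_one_add (R := ℂ)
    (K := Metric.closedBall (0 : ℂ) (‖a‖ + 1))
    (f := fun j b ↦ -(b * q ^ j)) (isCompact_closedBall _ _)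
    ((summable_geometric_of_lt_one (norm_nonneg _) hq).mul_left (‖a‖ + 1))
    (Eventually.of_forall fun n x hx ↦ by
      rw [norm_neg, norm_mul, norm_pow]
      exact mul_le_mul_of_nonneg_right (by simpa using hx) (by positivity))
    (fun n ↦ by fun_prop)
  simp only [← sub_eq_add_neg] at h
  have hc : ContinuousOn (fun b ↦ qPochInf b q) (Metric.closedBall (0 : ℂ) (‖a‖ + 1)) := by
    refine h.tendstoUniformlyOn.continuousOn
      (Eventually.frequently (Eventually.of_forall fun s ↦ ?_))
    fun_prop
  exact hc.continuousAt (Metric.closedBall_mem_nhds_of_mem (by simp))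

lemma tendsto_baileyFix {q u v : ℂ} (hq : ‖q‖ < 1)
    (hu : ∀ n : ℕ, 1 - u * q ^ (n + 1) ≠ 0) (hv : ∀ n : ℕ, 1 - v * q ^ (n + 1) ≠ 0)
    (huv : ∀ n : ℕ, 1 - u * v * q ^ (n + 1) ≠ 0) :
    Tendsto (fun p : ℕ × ℕ ↦ baileyFix q u v p.1 p.2) atTop
      (𝓝 ((qPochInf q q) ^ 2 * qPochInf (u * q) q * qPochInf (v * q) q *
        qPochInf (u * v * q) q)⁻¹) := by
  have key : ∀ {x : ℂ}, (∀ n : ℕ, 1 - x * q ^ (n + 1) ≠ 0) → qPochInf (x * q) q ≠ 0 :=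
    fun {x} h ↦ qPochInf_ne_zero hq fun n ↦ by simpa [pow_succ', mul_assoc] using h n
  have n0 := qPochInf_self_ne_zero hq
  have n1 := key hu
  have n2 := key hv
  have n3 := key huv
  have t1 : Tendsto (fun p : ℕ × ℕ ↦ p.1) atTop atTop := by
    rw [← prod_atTop_atTop_eq]; exact tendsto_fst
  have t2 : Tendsto (fun p : ℕ × ℕ ↦ p.2) atTop atTop := by
    rw [← prod_atTop_atTop_eq]; exact tendsto_snd
  have t12 : Tendsto (fun p : ℕ × ℕ ↦ p.1 + p.2) atTop atTop :=
    tendsto_atTop_mono (fun p ↦ Nat.le_add_right p.1 p.2) t1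
  have t := ((tendsto_qPoch hq (u * v * q)).comp t12).mul
    (((((tendsto_qPoch hq q).inv₀ n0).comp t1).mul (((tendsto_qPoch hq (u * q)).inv₀ n1).comp t1)
      |>.mul (((tendsto_qPoch hq (u * v * q)).inv₀ n3).comp t1)).mul
    ((((tendsto_qPoch hq q).inv₀ n0).comp t2).mul (((tendsto_qPoch hq (v * q)).inv₀ n2).comp t2)
      |>.mul (((tendsto_qPoch hq (u * v * q)).inv₀ n3).comp t2)))
  have e : ∀ {c d : ℂ}, c = d → 𝓝 c ≤ 𝓝 d := fun h ↦ h ▸ le_rfl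
  refine Tendsto.mono_right (t.congr fun p ↦ rfl) (e ?_)
  field_simp

lemma tendsto_shiftL {f : ℕ → ℕ → ℂ} {c : ℂ}
    (h : Tendsto (fun p : ℕ × ℕ ↦ f p.1 p.2) atTop (𝓝 c)) :
    Tendsto (fun p : ℕ × ℕ ↦ shiftL f p.1 p.2) atTop (𝓝 c) := by
  rw [← prod_atTop_atTop_eq] at h ⊢
  have h1 : Tendsto (fun p : ℕ × ℕ ↦ (p.1 - 1, p.2)) (atTop ×ˢ atTop) (atTop ×ˢ atTop) :=
    ((tendsto_sub_atTop_nat 1).comp tendsto_fst).prodMk tendsto_snd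
  refine (h.comp h1).congr' ?_
  filter_upwards [tendsto_fst.eventually (eventually_ge_atTop 1)] with p hp
  obtain ⟨n, hn⟩ := Nat.exists_eq_add_of_le' hp
  simp [hn]

lemma tendsto_shiftR {f : ℕ → ℕ → ℂ} {c : ℂ}
    (h : Tendsto (fun p : ℕ × ℕ ↦ f p.1 p.2) atTop (𝓝 c)) :
    Tendsto (fun p : ℕ × ℕ ↦ shiftR f p.1 p.2) atTop (𝓝 c) := by
  rw [← prod_atTop_atTop_eq] at h ⊢
  have h1 : Tendsto (fun p : ℕ × ℕ ↦ (p.1, p.2 - 1)) (atTop ×ˢ atTop) (atTop ×ˢ atTop) :=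
    tendsto_fst.prodMk ((tendsto_sub_atTop_nat 1).comp tendsto_snd)
  refine (h.comp h1).congr' ?_
  filter_upwards [tendsto_snd.eventually (eventually_ge_atTop 1)] with p hp
  obtain ⟨n, hn⟩ := Nat.exists_eq_add_of_le' hp
  simp [hn]

lemma baileyOp_eigen_baileyFix {q u v : ℂ} (hq : ‖q‖ < 1) (hq0 : q ≠ 0)
    (hu : ∀ n : ℕ, 1 - u * q ^ (n + 1) ≠ 0) (hv : ∀ n : ℕ, 1 - v * q ^ (n + 1) ≠ 0)
    (huv : ∀ n : ℕ, 1 - u * v * q ^ (n + 1) ≠ 0) :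
    baileyOp q u v (baileyFix q u v) = (1 : ℂ) • baileyFix q u v := by
  rw [one_smul, baileyOp_baileyFix hq hq0 hu hv huv]

lemma one_sub_mul_pow_ne_zero {q z : ℂ} (hq : ‖q‖ < 1) (hz : ‖z‖ < 1) (n : ℕ) :
    1 - z * q ^ n ≠ 0 := by
  refine one_sub_ne_zero_of_norm_lt ?_
  rw [norm_mul, norm_pow]
  exact mul_lt_one_of_nonneg_of_lt_one_left (norm_nonneg _) hz
    (pow_le_one₀ (norm_nonneg _) hq.le)

lemma one_sub_div_mul_pow_ne_zero {q z : ℂ} (hq : ‖q‖ < 1) (hq0 : q ≠ 0) (hz : ‖z‖ < 1)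
    (h : z ≠ q) (n : ℕ) : 1 - z * q⁻¹ * q ^ n ≠ 0 := by
  cases n with
  | zero =>
    rw [pow_zero, mul_one, sub_ne_zero, ← div_eq_mul_inv]
    exact fun h' ↦ h ((eq_div_iff hq0).1 h' |>.symm.trans (one_mul q))
  | succ n =>
    rw [pow_succ', mul_assoc, inv_mul_cancel_left₀ hq0]
    exact one_sub_mul_pow_ne_zero hq hz n

/-- Iterating the operator on the fixed point with equal parameters. -/
lemma baileyOp_iterate_baileyFix {q z : ℂ} (hq : ‖q‖ < 1) (hq0 : q ≠ 0) (hz : ‖z‖ < 1) (n : ℕ) :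
    (baileyOp q z (z * q⁻¹))^[n] (baileyFix q z z) = baileyFix q z (z * q⁻¹)
      + (-z / ((1 - z) * (1 - z * q)) * z ^ n) • shiftR (baileyFix q (z * q⁻¹) (z * q))
      + (z ^ 3 / ((1 - z) * (1 - z * q) * (1 - z ^ 2) * (1 - z ^ 2 * q)) * (z ^ 2) ^ n) •
        shiftL (shiftR (baileyFix q (z * q) z)) := by
  have hz2 : ‖z ^ 2‖ < 1 := norm_sq_lt_one hz
  have A := one_sub_mul_pow_ne_zero hq hz
  have B := one_sub_mul_pow_ne_zero hq hz2
  have e0 : baileyFix q z z = _ := baileyFix_expand_right hq hq0 A A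
    (fun n ↦ by simpa only [sq] using B n)
  have e1 : baileyOp q z (z * q⁻¹) (baileyFix q z (z * q⁻¹)) =
      (1 : ℂ) • baileyFix q z (z * q⁻¹) := by
    refine baileyOp_eigen_baileyFix hq hq0 (fun n ↦ A _) (fun n ↦ ?_) fun n ↦ ?_
    · convert A n using 2; field_simp; ring
    · convert B n using 2; field_simp; ring
  have e2 := baileyOp_shiftR_eigen (x := z) (y := z * q⁻¹) (c' := z) hq0
    (baileyOp_eigen_baileyFix (u := z * q⁻¹) (v := z * q) hq hq0
      (fun n ↦ by convert A n using 2; field_simp; ring)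
      (fun n ↦ by convert A (n + 2) using 2; ring)
      (fun n ↦ by convert B (n + 1) using 2; field_simp)) rfl (by field_simp)
    (by field_simp)
  have e3 := baileyOp_shiftL_eigen (x := z) (y := z * q⁻¹) (c' := z ^ 2) hq0
    (baileyOp_shiftR_eigen (x := z * q ^ 2) (y := z * q⁻¹ * q⁻¹) hq0
      (baileyOp_eigen_baileyFix (u := z * q) (v := z) hq hq0
        (fun n ↦ by convert A (n + 2) using 2; ring) (fun n ↦ A _)
        (fun n ↦ by convert B (n + 2) using 2; ring)) (by field_simp) (by field_simp) rfl) rfl rfl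
    (by field_simp)
  rw [e0, baileyOp_iterate_add, baileyOp_iterate_add, baileyOp_iterate_smul,
    baileyOp_iterate_smul, baileyOp_iterate_eigen e1, baileyOp_iterate_eigen e2,
    baileyOp_iterate_eigen e3, smul_smul, smul_smul, one_pow, one_smul, ← sq, ← pow_succ]

lemma tendsto_baileyOp_iterate {q x y : ℂ} {g f₁ f₂ f₃ : ℕ → ℕ → ℂ}
    {c₂ c₃ e₁ e₂ e₃ l₁ l₂ l₃ : ℂ} (hg : g = f₁ + c₂ • f₂ + c₃ • f₃)
    (h₁ : baileyOp q x y f₁ = e₁ • f₁) (h₂ : baileyOp q x y f₂ = e₂ • f₂)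
    (h₃ : baileyOp q x y f₃ = e₃ • f₃)
    (t₁ : Tendsto (fun p : ℕ × ℕ ↦ f₁ p.1 p.2) atTop (𝓝 l₁))
    (t₂ : Tendsto (fun p : ℕ × ℕ ↦ f₂ p.1 p.2) atTop (𝓝 l₂))
    (t₃ : Tendsto (fun p : ℕ × ℕ ↦ f₃ p.1 p.2) atTop (𝓝 l₃)) (a : ℕ) :
    Tendsto (fun p : ℕ × ℕ ↦ (baileyOp q x y)^[a] g p.1 p.2) atTop
      (𝓝 (e₁ ^ a * l₁ + c₂ * (e₂ ^ a * l₂) + c₃ * (e₃ ^ a * l₃))) := by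
  rw [hg, baileyOp_iterate_add, baileyOp_iterate_add, baileyOp_iterate_smul,
    baileyOp_iterate_smul, baileyOp_iterate_eigen h₁, baileyOp_iterate_eigen h₂,
    baileyOp_iterate_eigen h₃]
  exact ((t₁.const_mul _).add ((t₂.const_mul _).const_mul _)).add ((t₃.const_mul _).const_mul _)

lemma one_sub_mul_pow_ne_zero_of_eq {q c x : ℂ} (h : ∀ n : ℕ, 1 - c * q ^ n ≠ 0) (k : ℕ)
    (hx : x = c * q ^ k) (n : ℕ) : 1 - x * q ^ n ≠ 0 := by
  rw [hx, mul_assoc, ← pow_add]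
  exact h _

lemma one_sub_mul_pow_succ_ne_zero_of_eq {q c x : ℂ} (h : ∀ n : ℕ, 1 - c * q ^ n ≠ 0) (k : ℕ)
    (hx : x * q = c * q ^ k) (n : ℕ) : 1 - x * q ^ (n + 1) ≠ 0 := by
  rw [pow_succ', ← mul_assoc]
  exact one_sub_mul_pow_ne_zero_of_eq h k hx n

lemma tendsto_iterate_baileyFix_left {q p : ℂ} (hq : ‖q‖ < 1) (hq0 : q ≠ 0)
    (hp : ∀ n : ℕ, 1 - p * q ^ n ≠ 0) (hp2 : ∀ n : ℕ, 1 - p ^ 2 * q * q ^ n ≠ 0) (a : ℕ) :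
    Tendsto (fun x : ℕ × ℕ ↦ (baileyOp q p p)^[a] (baileyFix q (p * q) p) x.1 x.2) atTop
      (𝓝 (1 ^ a * ((qPochInf q q) ^ 2 * qPochInf (p * q) q * qPochInf (p * q) q *
            qPochInf (p * p * q) q)⁻¹ +
          -(p * q) / ((1 - p * q) * (1 - p * q * q)) * ((p * q) ^ a *
            ((qPochInf q q) ^ 2 * qPochInf (p * q * q * q) q * qPochInf (p * q⁻¹ * q) q *
            qPochInf (p * q * q * (p * q⁻¹) * q) q)⁻¹) +
          p ^ 2 * (p * q) / ((1 - p) * (1 - p * q) * (1 - p * q * p) * (1 - p * q * p * q)) *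
          ((p ^ 2 * q) ^ a *
            ((qPochInf q q) ^ 2 * qPochInf (p * q * q) q * qPochInf (p * q * q) q *
            qPochInf (p * q * (p * q) * q) q)⁻¹))) := by
  have N := fun {x : ℂ} ↦ one_sub_mul_pow_ne_zero_of_eq (x := x) hp
  have N' := fun {x : ℂ} ↦ one_sub_mul_pow_succ_ne_zero_of_eq (x := x) hp
  have M := fun {x : ℂ} ↦ one_sub_mul_pow_ne_zero_of_eq (x := x) hp2
  have M' := fun {x : ℂ} ↦ one_sub_mul_pow_succ_ne_zero_of_eq (x := x) hp2
  have e := baileyFix_expand_left hq hq0 (u := p * q) (v := p) (N 1 (by ring)) (N 0 (by ring))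
    (M 0 (by ring))
  rw [mul_inv_cancel_right₀ hq0] at e
  have u1 := N' (x := p) 1 (by ring)
  have u2 := N' (x := p * q * q) 3 (by ring)
  have u3 := N' (x := p * q⁻¹) 0 (by field_simp)
  have u4 := N' (x := p * q) 2 (by ring)
  have v1 := M' (x := p * p) 0 (by ring)
  have v2 := M' (x := p * q * q * (p * q⁻¹)) 1 (by field_simp)
  have v3 := M' (x := p * q * (p * q)) 2 (by ring)
  refine tendsto_baileyOp_iterate e (baileyOp_eigen_baileyFix hq hq0 u1 u1 v1) ?_ ?_
    (tendsto_baileyFix hq u1 u1 v1) (tendsto_shiftL (tendsto_baileyFix hq u2 u3 v2))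
    (tendsto_shiftL (tendsto_shiftR (tendsto_baileyFix hq u4 u4 v3))) a
  · exact baileyOp_shiftL_eigen hq0 (baileyOp_eigen_baileyFix hq hq0 u2 u3 v2) (by ring) rfl
      (by ring)
  · exact baileyOp_shiftL_eigen hq0 (baileyOp_shiftR_eigen hq0
      (baileyOp_eigen_baileyFix hq hq0 u4 u4 v3) (by field_simp) (by field_simp) rfl) rfl rfl
      (by field_simp)

lemma tendsto_iterate_shiftR_baileyFix {q p : ℂ} (hq : ‖q‖ < 1) (hq0 : q ≠ 0)
    (hp : ∀ n : ℕ, 1 - p * q ^ n ≠ 0) (hp2 : ∀ n : ℕ, 1 - p ^ 2 * q * q ^ n ≠ 0) (a : ℕ) :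
    Tendsto (fun x : ℕ × ℕ ↦
      (baileyOp q p p)^[a] (shiftR (baileyFix q p (p * q * q))) x.1 x.2) atTop
      (𝓝 ((p * q) ^ a * ((qPochInf q q) ^ 2 * qPochInf (p * q⁻¹ * q) q *
            qPochInf (p * q * q * q) q * qPochInf (p * q⁻¹ * (p * q * q) * q) q)⁻¹ +
          -p / ((1 - p) * (1 - p * q)) * ((p ^ 2 * q) ^ a *
            ((qPochInf q q) ^ 2 * qPochInf (p * q * q) q * qPochInf (p * q * q) q *
            qPochInf (p * q * (p * q) * q) q)⁻¹) +
          (p * q * q) ^ 2 * p / ((1 - p * q * q) * (1 - p * q * q * q) *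
            (1 - p * (p * q * q)) * (1 - p * (p * q * q) * q)) *
          ((p ^ 3 * q ^ 3) ^ a *
            ((qPochInf q q) ^ 2 * qPochInf (p * q) q * qPochInf (p * q * q * q * q) q *
            qPochInf (p * (p * q * q * q) * q) q)⁻¹))) := by
  have N := fun {x : ℂ} ↦ one_sub_mul_pow_ne_zero_of_eq (x := x) hp
  have N' := fun {x : ℂ} ↦ one_sub_mul_pow_succ_ne_zero_of_eq (x := x) hp
  have M := fun {x : ℂ} ↦ one_sub_mul_pow_ne_zero_of_eq (x := x) hp2
  have M' := fun {x : ℂ} ↦ one_sub_mul_pow_succ_ne_zero_of_eq (x := x) hp2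
  have e := congrArg shiftR (baileyFix_expand_left hq hq0 (u := p) (v := p * q * q)
    (N 0 (by ring)) (N 2 (by ring)) (M 1 (by ring)))
  rw [mul_inv_cancel_right₀ hq0, shiftR_add, shiftR_add, shiftR_smul, shiftR_smul] at e
  have u1 := N' (x := p * q⁻¹) 0 (by field_simp)
  have u2 := N' (x := p * q * q) 3 (by ring)
  have u3 := N' (x := p * q) 2 (by ring)
  have u4 := N' (x := p) 1 (by ring)
  have u5 := N' (x := p * q * q * q) 4 (by ring)
  have v1 := M' (x := p * q⁻¹ * (p * q * q)) 1 (by field_simp)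
  have v2 := M' (x := p * q * (p * q)) 2 (by ring)
  have v3 := M' (x := p * (p * q * q * q)) 3 (by ring)
  refine tendsto_baileyOp_iterate e ?_ ?_ ?_
    (tendsto_shiftR (tendsto_baileyFix hq u1 u2 v1))
    (tendsto_shiftR (tendsto_shiftL (tendsto_baileyFix hq u3 u3 v2)))
    (tendsto_shiftR (tendsto_shiftL (tendsto_shiftR (tendsto_baileyFix hq u4 u5 v3)))) a
  · exact baileyOp_shiftR_eigen hq0 (baileyOp_eigen_baileyFix hq hq0 u1 u2 v1) rfl (by ring)
      (by ring)
  · exact baileyOp_shiftR_eigen hq0 (baileyOp_shiftL_eigen hq0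
      (baileyOp_eigen_baileyFix hq hq0 u3 u3 v2) (by field_simp) (by field_simp) rfl) rfl rfl
      (by field_simp)
  · exact baileyOp_shiftR_eigen hq0 (baileyOp_shiftL_eigen hq0 (baileyOp_shiftR_eigen hq0
      (baileyOp_eigen_baileyFix hq hq0 u4 u5 v3) (by field_simp) (by field_simp) rfl) rfl rfl rfl)
      rfl rfl (by field_simp)

lemma tendsto_iterate_shiftL_shiftR_baileyFix {q p : ℂ} (hq : ‖q‖ < 1) (hq0 : q ≠ 0)
    (hp : ∀ n : ℕ, 1 - p * q ^ n ≠ 0) (hp2 : ∀ n : ℕ, 1 - p ^ 2 * q * q ^ n ≠ 0) (a : ℕ) :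
    Tendsto (fun x : ℕ × ℕ ↦
      (baileyOp q p p)^[a] (shiftL (shiftR (baileyFix q (p * q * q) (p * q)))) x.1 x.2) atTop
      (𝓝 ((p ^ 2 * q) ^ a * ((qPochInf q q) ^ 2 * qPochInf (p * q * q) q *
            qPochInf (p * q * q) q * qPochInf (p * q * (p * q) * q) q)⁻¹ +
          -(p * q * q) / ((1 - p * q * q) * (1 - p * q * q * q)) * ((p ^ 3 * q ^ 3) ^ a *
            ((qPochInf q q) ^ 2 * qPochInf (p * q * q * q * q) q * qPochInf (p * q) q *
            qPochInf (p * q * q * q * p * q) q)⁻¹) +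
          (p * q) ^ 2 * (p * q * q) / ((1 - p * q) * (1 - p * q * q) *
            (1 - p * q * q * (p * q)) * (1 - p * q * q * (p * q) * q)) *
          ((p ^ 4 * q ^ 4) ^ a *
            ((qPochInf q q) ^ 2 * qPochInf (p * q * q * q) q * qPochInf (p * q * q * q) q *
            qPochInf (p * q * q * (p * q * q) * q) q)⁻¹))) := by
  have N := fun {x : ℂ} ↦ one_sub_mul_pow_ne_zero_of_eq (x := x) hp
  have N' := fun {x : ℂ} ↦ one_sub_mul_pow_succ_ne_zero_of_eq (x := x) hp
  have M := fun {x : ℂ} ↦ one_sub_mul_pow_ne_zero_of_eq (x := x) hp2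
  have M' := fun {x : ℂ} ↦ one_sub_mul_pow_succ_ne_zero_of_eq (x := x) hp2
  have e := congrArg (fun f ↦ shiftL (shiftR f)) (baileyFix_expand_left hq hq0 (u := p * q * q)
    (v := p * q) (N 2 (by ring)) (N 1 (by ring)) (M 2 (by ring)))
  simp only [mul_inv_cancel_right₀ hq0, shiftR_add, shiftR_smul, shiftL_add, shiftL_smul] at e
  have u1 := N' (x := p * q) 2 (by ring)
  have u2 := N' (x := p * q * q * q) 4 (by ring)
  have u3 := N' (x := p) 1 (by ring)
  have u4 := N' (x := p * q * q) 3 (by ring)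
  have v1 := M' (x := p * q * (p * q)) 2 (by ring)
  have v2 := M' (x := p * q * q * q * p) 3 (by ring)
  have v3 := M' (x := p * q * q * (p * q * q)) 4 (by ring)
  refine tendsto_baileyOp_iterate e ?_ ?_ ?_
    (tendsto_shiftL (tendsto_shiftR (tendsto_baileyFix hq u1 u1 v1)))
    (tendsto_shiftL (tendsto_shiftR (tendsto_shiftL (tendsto_baileyFix hq u2 u3 v2))))
    (tendsto_shiftL (tendsto_shiftR (tendsto_shiftL (tendsto_shiftR
      (tendsto_baileyFix hq u4 u4 v3))))) a
  · exact baileyOp_shiftL_eigen hq0 (baileyOp_shiftR_eigen hq0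
      (baileyOp_eigen_baileyFix hq hq0 u1 u1 v1) (by field_simp) (by field_simp) rfl) rfl rfl
      (by field_simp)
  · exact baileyOp_shiftL_eigen hq0 (baileyOp_shiftR_eigen hq0 (baileyOp_shiftL_eigen hq0
      (baileyOp_eigen_baileyFix hq hq0 u2 u3 v2) (by field_simp) (by field_simp) rfl) rfl rfl rfl)
      rfl rfl (by field_simp)
  · exact baileyOp_shiftL_eigen hq0 (baileyOp_shiftR_eigen hq0 (baileyOp_shiftL_eigen hq0
      (baileyOp_shiftR_eigen hq0 (baileyOp_eigen_baileyFix hq hq0 u4 u4 v3) (by field_simp)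
      (by field_simp) rfl) rfl rfl rfl) rfl rfl rfl) rfl rfl (by field_simp)

lemma qPochInf_mul_base {q : ℂ} (hq : ‖q‖ < 1) {a : ℂ} (h : 1 - a ≠ 0) :
    qPochInf (a * q) q = qPochInf a q / (1 - a) := by
  rw [qPochInf_eq_mul hq a, mul_div_cancel_left₀ _ h]

lemma tendsto_iterate_iterate_baileyFix {q p : ℂ} (hq : ‖q‖ < 1) (hq0 : q ≠ 0)
    (hz : ‖p * q‖ < 1) (hp : ∀ n : ℕ, 1 - p * q ^ n ≠ 0)
    (hp2 : ∀ n : ℕ, 1 - p ^ 2 * q * q ^ n ≠ 0) (n : ℕ) :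
    ∃ c : ℂ, ∀ a : ℕ, Tendsto (fun x : ℕ × ℕ ↦
      (baileyOp q p p)^[a] ((baileyOp q (p * q) p)^[n] (baileyFix q (p * q) (p * q))) x.1 x.2)
      atTop (𝓝 ((qPochInf q q ^ 2 * qPochInf (p * q * q) q ^ 2 * qPochInf (p ^ 2 * q ^ 3) q *
        (1 - p * q) ^ 2 * (1 - p ^ 2 * q ^ 2))⁻¹ *
        (1 / (1 - p ^ 2 * q) - p * q * (p * q) ^ a * (1 + (p * q) ^ n) / (1 - p)
          - p ^ 4 * q ^ 5 * (p ^ 3 * q ^ 3) ^ a * ((p * q) ^ n + (p ^ 2 * q ^ 2) ^ n) /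
            (1 - p * q ^ 2)
          + p ^ 6 * q ^ 7 * (p ^ 4 * q ^ 4) ^ a * (p ^ 2 * q ^ 2) ^ n / (1 - p ^ 2 * q ^ 3))
        + c * (p ^ 2 * q) ^ a)) := by
  have e := baileyOp_iterate_baileyFix hq hq0 hz n
  rw [mul_inv_cancel_right₀ hq0] at e
  have hq' := qPochInf_self_ne_zero hq
  have n1 : 1 - p ≠ 0 := by simpa using hp 0
  have n2 : 1 - p * q ≠ 0 := by simpa using hp 1
  have n3 : 1 - p * q ^ 2 ≠ 0 := hp 2
  have n4 : 1 - p * q ^ 3 ≠ 0 := hp 3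
  have n5 : 1 - p ^ 2 * q ≠ 0 := by simpa using hp2 0
  have n6 : 1 - p ^ 2 * q ^ 2 ≠ 0 := by convert hp2 1 using 1; ring
  have n7 : 1 - p ^ 2 * q ^ 3 ≠ 0 := by convert hp2 2 using 1; ring
  have n8 : 1 - p ^ 2 * q ^ 4 ≠ 0 := by convert hp2 3 using 1; ring
  have hA : qPochInf p q ≠ 0 := qPochInf_ne_zero hq hp
  have hB : qPochInf (p ^ 2 * q) q ≠ 0 := qPochInf_ne_zero hq hp2
  have a1 : qPochInf (p * q) q = qPochInf p q / (1 - p) := qPochInf_mul_base hq n1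
  have a2 : qPochInf (p * q ^ 2) q = qPochInf p q / ((1 - p) * (1 - p * q)) := by
    rw [sq, ← mul_assoc, qPochInf_mul_base hq n2, a1, div_div]
  have a3 : qPochInf (p * q ^ 3) q = qPochInf p q / ((1 - p) * (1 - p * q) * (1 - p * q ^ 2)) := by
    rw [pow_succ, ← mul_assoc, qPochInf_mul_base hq n3, a2, div_div]
  have a4 : qPochInf (p * q ^ 4) q =
      qPochInf p q / ((1 - p) * (1 - p * q) * (1 - p * q ^ 2) * (1 - p * q ^ 3)) := by
    rw [pow_succ, ← mul_assoc, qPochInf_mul_base hq n4, a3, div_div]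
  have b2 : qPochInf (p ^ 2 * q ^ 2) q = qPochInf (p ^ 2 * q) q / (1 - p ^ 2 * q) := by
    rw [sq q, ← mul_assoc, qPochInf_mul_base hq n5]
  have b3 : qPochInf (p ^ 2 * q ^ 3) q =
      qPochInf (p ^ 2 * q) q / ((1 - p ^ 2 * q) * (1 - p ^ 2 * q ^ 2)) := by
    rw [pow_succ q, ← mul_assoc, qPochInf_mul_base hq n6, b2, div_div]
  have b4 : qPochInf (p ^ 2 * q ^ 4) q =
      qPochInf (p ^ 2 * q) q / ((1 - p ^ 2 * q) * (1 - p ^ 2 * q ^ 2) * (1 - p ^ 2 * q ^ 3)) := by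
    rw [pow_succ q, ← mul_assoc, qPochInf_mul_base hq n7, b3, div_div]
  have b5 : qPochInf (p ^ 2 * q ^ 5) q = qPochInf (p ^ 2 * q) q /
      ((1 - p ^ 2 * q) * (1 - p ^ 2 * q ^ 2) * (1 - p ^ 2 * q ^ 3) * (1 - p ^ 2 * q ^ 4)) := by
    rw [pow_succ q, ← mul_assoc, qPochInf_mul_base hq n8, b4, div_div]
  refine ⟨(p ^ 2 * (p * q) / ((1 - p) * (1 - p * q) * (1 - p * q * p) * (1 - p * q * p * q)) +
    -(p * q) / ((1 - p * q) * (1 - p * q * q)) * (p * q) ^ n * (-p / ((1 - p) * (1 - p * q))) +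
    (p * q) ^ 3 / ((1 - p * q) * (1 - p * q * q) * (1 - (p * q) ^ 2) * (1 - (p * q) ^ 2 * q)) *
      ((p * q) ^ 2) ^ n) * (qPochInf q q ^ 2 * qPochInf (p * q * q) q *
      qPochInf (p * q * q) q * qPochInf (p * q * (p * q) * q) q)⁻¹, fun a ↦ ?_⟩
  rw [e]
  simp only [baileyOp_iterate_add, baileyOp_iterate_smul]
  have t := ((tendsto_iterate_baileyFix_left hq hq0 hp hp2 a).add
    ((tendsto_iterate_shiftR_baileyFix hq hq0 hp hp2 a).const_mul
      (-(p * q) / ((1 - p * q) * (1 - p * q * q)) * (p * q) ^ n))).add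
    ((tendsto_iterate_shiftL_shiftR_baileyFix hq hq0 hp hp2 a).const_mul
      ((p * q) ^ 3 / ((1 - p * q) * (1 - p * q * q) * (1 - (p * q) ^ 2) * (1 - (p * q) ^ 2 * q)) *
      ((p * q) ^ 2) ^ n))
  have h : ∀ {c d : ℂ}, c = d → 𝓝 c ≤ 𝓝 d := fun h ↦ h ▸ le_rfl
  refine Tendsto.mono_right (t.congr fun p ↦ rfl) (h ?_)
  have r1 : p * q * q = p * q ^ 2 := by ring
  have r2 : p * q ^ 2 * q = p * q ^ 3 := by ring
  have r3 : p * q ^ 3 * q = p * q ^ 4 := by ring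
  have r4 : p * p * q = p ^ 2 * q := by ring
  have r5 : p * q ^ 2 * (p * q⁻¹) * q = p ^ 2 * q ^ 2 := by field_simp
  have r6 : p * q * (p * q) * q = p ^ 2 * q ^ 3 := by ring
  have r7 : p * (p * q ^ 3) * q = p ^ 2 * q ^ 4 := by ring
  have r8 : p * q ^ 3 * p * q = p ^ 2 * q ^ 4 := by ring
  have r9 : p * q ^ 2 * (p * q ^ 2) * q = p ^ 2 * q ^ 5 := by ring
  have r10 : p * q⁻¹ * (p * q ^ 2) * q = p ^ 2 * q ^ 2 := by field_simp
  have r11 : p * q⁻¹ * q = p := by field_simp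
  have r12 : p * q * p = p ^ 2 * q := by ring
  have r13 : p ^ 2 * q * q = p ^ 2 * q ^ 2 := by ring
  have r14 : (p * q) ^ 2 = p ^ 2 * q ^ 2 := by ring
  have r15 : p ^ 2 * q ^ 2 * q = p ^ 2 * q ^ 3 := by ring
  have r16 : p * (p * q ^ 2) = p ^ 2 * q ^ 2 := by ring
  have r17 : p * q ^ 2 * (p * q) = p ^ 2 * q ^ 3 := by ring
  have r18 : p ^ 2 * q ^ 3 * q = p ^ 2 * q ^ 4 := by ring
  simp only [r1, r2, r3, r4, r5, r6, r7, r8, r9, r10, r11, r12, r13, r14, r15, r16, r17, r18]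
  simp only [a1, a2, a3, a4, b2, b3, b4, b5]
  have hY : (p ^ 2 * q ^ 2) ^ n = ((p * q) ^ n) ^ 2 := by rw [← pow_mul, mul_comm n, pow_mul, r14]
  rw [hY]
  generalize (p * q) ^ n = Y
  generalize (p * q) ^ a = X1
  generalize (p ^ 3 * q ^ 3) ^ a = X3
  generalize (p ^ 4 * q ^ 4) ^ a = X4
  generalize (p ^ 2 * q) ^ a = X0
  generalize qPochInf p q = A at *
  generalize qPochInf (p ^ 2 * q) q = B at *
  generalize qPochInf q q = Q at *
  field_simp
  ring

lemma exists_limit_iterate_iterate_baileyFix {q z : ℂ} (hq : ‖q‖ < 1) (hq0 : q ≠ 0)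
    (hz : ‖z‖ < 1) (h1 : z ≠ q) (h2 : z ^ 2 ≠ q) (n : ℕ) :
    ∃ l : ℕ → ℂ, (∀ a, Tendsto (fun x : ℕ × ℕ ↦ (baileyOp q (z * q⁻¹) (z * q⁻¹))^[a]
        ((baileyOp q z (z * q⁻¹))^[n] (baileyFix q z z)) x.1 x.2) atTop (𝓝 (l a))) ∧
      ∀ a, l (a + 1) - z ^ 2 * q⁻¹ * l a = (qPochInf q q ^ 2)⁻¹ *
        (1 / (qPochInf (z * q) q * qPochInf (z * q) q * qPochInf (z ^ 2 * q) q) *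
          ((1 - z ^ (a + 2)) * (1 - z ^ (a + n + 2)) * (1 - z ^ (2 * a + n + 4)) /
            ((1 - z) * (1 - z) * (1 - z ^ 2)))) := by
  obtain ⟨p, rfl⟩ : ∃ p, z = p * q := ⟨z * q⁻¹, by field_simp⟩
  have hz2 : ‖(p * q) ^ 2‖ < 1 := norm_sq_lt_one hz
  have hp : ∀ n : ℕ, 1 - p * q ^ n ≠ 0 := by
    simpa only [mul_inv_cancel_right₀ hq0] using one_sub_div_mul_pow_ne_zero hq hq0 hz h1
  have hp2 : ∀ n : ℕ, 1 - p ^ 2 * q * q ^ n ≠ 0 := by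
    have h : (p * q) ^ 2 * q⁻¹ = p ^ 2 * q := by field_simp
    simpa only [h] using one_sub_div_mul_pow_ne_zero hq hq0 hz2 h2
  rw [mul_inv_cancel_right₀ hq0]
  obtain ⟨c, hc⟩ := tendsto_iterate_iterate_baileyFix hq hq0 hz hp hp2 n
  refine ⟨_, hc, fun a ↦ ?_⟩
  have hA : qPochInf (p * q ^ 2) q ≠ 0 := qPochInf_ne_zero hq
    (one_sub_mul_pow_ne_zero_of_eq hp 2 rfl)
  have hB : qPochInf (p ^ 2 * q ^ 3) q ≠ 0 := qPochInf_ne_zero hq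
    (one_sub_mul_pow_ne_zero_of_eq hp2 2 (by ring))
  have hQ := qPochInf_self_ne_zero hq
  have n1 : 1 - p ≠ 0 := by simpa using hp 0
  have n2 : 1 - p * q ≠ 0 := by simpa using hp 1
  have n3 : 1 - p * q ^ 2 ≠ 0 := hp 2
  have n5 : 1 - p ^ 2 * q ≠ 0 := by simpa using hp2 0
  have n6 : 1 - p ^ 2 * q ^ 2 ≠ 0 := by convert hp2 1 using 1; ring
  have n7 : 1 - p ^ 2 * q ^ 3 ≠ 0 := by convert hp2 2 using 1; ring
  have r1 : p * q * q = p * q ^ 2 := by ring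
  have r2 : (p * q) ^ 2 = p ^ 2 * q ^ 2 := by ring
  have r3 : p ^ 2 * q ^ 2 * q = p ^ 2 * q ^ 3 := by ring
  have r4 : p ^ 2 * q ^ 2 * q⁻¹ = p ^ 2 * q := by field_simp
  have e1 : (p * q) ^ (a + 2) = (p * q) ^ a * (p * q) ^ 2 := by ring
  have e2 : (p * q) ^ (a + n + 2) = (p * q) ^ a * (p * q) ^ n * (p * q) ^ 2 := by ring
  have e3 : (p * q) ^ (2 * a + n + 4) = ((p * q) ^ a) ^ 2 * (p * q) ^ n * (p * q) ^ 4 := by ring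
  have e4 : (p ^ 3 * q ^ 3) ^ a = ((p * q) ^ a) ^ 3 := by
    rw [← mul_pow, ← pow_mul, ← pow_mul, mul_comm _ a]
  have e5 : (p ^ 4 * q ^ 4) ^ a = ((p * q) ^ a) ^ 4 := by
    rw [← mul_pow, ← pow_mul, ← pow_mul, mul_comm _ a]
  have e6 : (p ^ 2 * q ^ 2) ^ n = ((p * q) ^ n) ^ 2 := by
    rw [← mul_pow, ← pow_mul, ← pow_mul, mul_comm _ n]
  rw [e1, e2, e3]
  simp only [r1, r2, r3, r4, pow_succ _ a, e4, e5, e6]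
  generalize (p * q) ^ n = Y
  generalize (p * q) ^ a = X
  generalize (p ^ 2 * q) ^ a = X0
  generalize qPochInf (p * q ^ 2) q = A at *
  generalize qPochInf (p ^ 2 * q ^ 3) q = B at *
  generalize qPochInf q q = Q at *
  field_simp
  ring

lemma tendsto_iterate_baileyFix {q z : ℂ} (hq : ‖q‖ < 1) (hq0 : q ≠ 0)
    (hz : ‖z‖ < 1) (n : ℕ) :
    Tendsto (fun x : ℕ × ℕ ↦ (baileyOp q z (z * q⁻¹))^[n] (baileyFix q z z) x.1 x.2) atTop
      (𝓝 ((qPochInf q q ^ 2)⁻¹ *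
        (1 / (qPochInf (z * q) q * qPochInf (z * q) q * qPochInf (z ^ 2 * q) q) *
          ((1 - z) * (1 - z ^ (n + 1)) * (1 - z ^ (n + 2)) /
            ((1 - z) * (1 - z) * (1 - z ^ 2)))))) := by
  have hz2 : ‖z ^ 2‖ < 1 := norm_sq_lt_one hz
  have N := one_sub_mul_pow_ne_zero hq hz
  have M := one_sub_mul_pow_ne_zero hq hz2
  have N' := fun {x : ℂ} ↦ one_sub_mul_pow_succ_ne_zero_of_eq (x := x) N
  have M' := fun {x : ℂ} ↦ one_sub_mul_pow_succ_ne_zero_of_eq (x := x) M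
  have u1 := N' (x := z) 1 (by ring)
  have u2 := N' (x := z * q⁻¹) 0 (by field_simp)
  have u3 := N' (x := z * q) 2 (by ring)
  have v1 := M' (x := z * (z * q⁻¹)) 0 (by field_simp)
  have v2 := M' (x := z * q⁻¹ * (z * q)) 1 (by field_simp)
  have v3 := M' (x := z * q * z) 2 (by ring)
  rw [baileyOp_iterate_baileyFix hq hq0 hz n]
  have t := ((tendsto_baileyFix hq u1 u2 v1).add
    ((tendsto_shiftR (tendsto_baileyFix hq u2 u3 v2)).const_mul
      (-z / ((1 - z) * (1 - z * q)) * z ^ n))).add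
    ((tendsto_shiftL (tendsto_shiftR (tendsto_baileyFix hq u3 u1 v3))).const_mul
      (z ^ 3 / ((1 - z) * (1 - z * q) * (1 - z ^ 2) * (1 - z ^ 2 * q)) * (z ^ 2) ^ n))
  have h : ∀ {c d : ℂ}, c = d → 𝓝 c ≤ 𝓝 d := fun h ↦ h ▸ le_rfl
  refine Tendsto.mono_right (t.congr fun p ↦ rfl) (h ?_)
  have n1 : 1 - z ≠ 0 := by simpa using N 0
  have n2 : 1 - z * q ≠ 0 := by simpa using N 1
  have m1 : 1 - z ^ 2 ≠ 0 := by simpa using M 0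
  have m2 : 1 - z ^ 2 * q ≠ 0 := by simpa using M 1
  have hA : qPochInf z q ≠ 0 := qPochInf_ne_zero hq N
  have hB : qPochInf (z ^ 2) q ≠ 0 := qPochInf_ne_zero hq M
  have hQ := qPochInf_self_ne_zero hq
  have a1 : qPochInf (z * q) q = qPochInf z q / (1 - z) := qPochInf_mul_base hq n1
  have a2 : qPochInf (z * q * q) q = qPochInf z q / ((1 - z) * (1 - z * q)) := by
    rw [qPochInf_mul_base hq n2, a1, div_div]
  have b1 : qPochInf (z ^ 2 * q) q = qPochInf (z ^ 2) q / (1 - z ^ 2) := qPochInf_mul_base hq m1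
  have b2 : qPochInf (z ^ 2 * q * q) q = qPochInf (z ^ 2) q / ((1 - z ^ 2) * (1 - z ^ 2 * q)) := by
    rw [qPochInf_mul_base hq m2, b1, div_div]
  have r1 : z * q⁻¹ * q = z := by field_simp
  have r2 : z * (z * q⁻¹) * q = z ^ 2 := by field_simp
  have r3 : z * q⁻¹ * (z * q) * q = z ^ 2 * q := by field_simp
  have r4 : z * q * z * q = z ^ 2 * q * q := by ring
  have e1 : (z ^ 2) ^ n = (z ^ n) ^ 2 := by rw [← pow_mul, ← pow_mul, mul_comm _ n]
  have e2 : z ^ (n + 2) = z ^ n * z ^ 2 := by ring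
  rw [e2]
  simp only [r1, r2, r3, r4, a1, a2, b1, b2, e1, pow_succ z n]
  generalize z ^ n = Y
  generalize qPochInf z q = A at *
  generalize qPochInf (z ^ 2) q = B at *
  generalize qPochInf q q = Q at *
  field_simp
  ring

/-! ### The sum over pairs of partitions -/

namespace Ptn

instance : CoeFun Ptn fun _ ↦ ℕ → ℕ := ⟨Subtype.val⟩

lemma succ_le (f : Ptn) (i : ℕ) : f (i + 1) ≤ f i := f.2.1 i (i + 1) i.le_succ

lemma sum_range_eq (f : Ptn) (n : ℕ) :
    ∑ i ∈ Finset.range n, f i =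
      ∑ i ∈ Finset.range n, (i + 1) * (f i - f (i + 1)) + n * f n := by
  induction n with
  | zero => simp
  | succ n ih =>
    obtain ⟨d, hd⟩ := Nat.exists_eq_add_of_le (f.succ_le n)
    rw [Finset.sum_range_succ, Finset.sum_range_succ, ih, hd, Nat.add_sub_cancel_left]
    ring

lemma ext_of_sub {f g : Ptn} {N : ℕ} (hf : ∀ i, N ≤ i → f i = 0) (hg : ∀ i, N ≤ i → g i = 0)
    (h : ∀ i < N, f i - f (i + 1) = g i - g (i + 1)) : f = g := by
  have key : ∀ k i, N ≤ i + k → f i = g i := by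
    intro k
    induction k with
    | zero => intro i hi; rw [hf i hi, hg i hi]
    | succ k ih =>
      intro i hi
      rcases le_or_gt N i with hN | hN
      · rw [hf i hN, hg i hN]
      · have h1 := ih (i + 1) (by omega)
        have h2 := h i hN
        have h3 := f.succ_le i
        have h4 := g.succ_le i
        omega
  exact Subtype.ext (funext fun i ↦ key N i (by omega))

/-- A majorant for the weight of a single partition. -/
def majorant (C ρ : ℝ) (f : ℕ → ℕ) : ℝ :=
  ∏' i, ρ ^ f i * if f i - f (i + 1) = 0 then 1 else C

lemma majorant_eq_prod {C ρ : ℝ} {f : ℕ → ℕ} {N : ℕ} (h : ∀ i, N ≤ i → f i = 0) :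
    majorant C ρ f =
      ∏ i ∈ Finset.range N, ρ ^ f i * if f i - f (i + 1) = 0 then 1 else C :=
  tprod_eq_prod fun i hi ↦ by simp [h i (by simpa using hi)]

lemma majorant_nonneg {C ρ : ℝ} (hC : 0 ≤ C) (hρ : 0 ≤ ρ) (f : Ptn) : 0 ≤ majorant C ρ f := by
  obtain ⟨N, hN⟩ := f.2.2
  rw [majorant_eq_prod hN]
  refine Finset.prod_nonneg fun i _ ↦ mul_nonneg (pow_nonneg hρ _) ?_
  split_ifs <;> simp [hC]

lemma majorant_eq_prod_sub {C ρ : ℝ} {f : Ptn} {N : ℕ} (h : ∀ i, N ≤ i → f i = 0) :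
    majorant C ρ f = ∏ i : Fin N, (ρ ^ ((i : ℕ) + 1)) ^ (f i - f (i + 1)) *
      if f i - f (i + 1) = 0 then 1 else C := by
  rw [majorant_eq_prod h, Finset.prod_mul_distrib, Finset.prod_pow_eq_pow_sum, sum_range_eq,
    h N le_rfl, mul_zero, add_zero, ← Finset.prod_pow_eq_pow_sum, ← Finset.prod_mul_distrib,
    ← Fin.prod_univ_eq_prod_range (fun i ↦ ρ ^ ((i + 1) * (f i - f (i + 1))) *
      if f i - f (i + 1) = 0 then (1 : ℝ) else C)]
  simp only [pow_mul]

lemma sum_majorant_factor_le {C ρ : ℝ} (hC : 0 ≤ C) (hρ : 0 ≤ ρ) (hρ1 : ρ < 1) (i M : ℕ) :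
    ∑ d ∈ Finset.range (M + 1), (ρ ^ (i + 1)) ^ d * (if d = 0 then 1 else C) ≤
      Real.exp (C * (1 - ρ)⁻¹ * ρ ^ (i + 1)) := by
  rw [Finset.sum_range_succ']
  have h1 : ∀ d ∈ Finset.range M, (ρ ^ (i + 1)) ^ (d + 1) * (if d + 1 = 0 then 1 else C) ≤
      C * ρ ^ (i + 1) * ρ ^ d := by
    intro d _
    rw [if_neg d.succ_ne_zero, pow_succ, mul_comm, mul_comm _ (ρ ^ (i + 1)), ← mul_assoc]
    refine mul_le_mul_of_nonneg_left ?_ (by positivity)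
    exact pow_le_pow_left₀ (by positivity) (pow_le_of_le_one hρ hρ1.le i.succ_ne_zero) d
  have h2 : ∑ d ∈ Finset.range M, ρ ^ d ≤ (1 - ρ)⁻¹ := by
    rw [← tsum_geometric_of_lt_one hρ hρ1]
    exact (summable_geometric_of_lt_one hρ hρ1).sum_le_tsum _ fun _ _ ↦ by positivity
  refine le_trans ?_ (Real.add_one_le_exp _)
  simp only [pow_zero, if_true, mul_one]
  gcongr
  refine (Finset.sum_le_sum h1).trans ?_
  rw [← Finset.mul_sum]
  calc _ ≤ C * ρ ^ (i + 1) * (1 - ρ)⁻¹ := mul_le_mul_of_nonneg_left h2 (by positivity)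
    _ = _ := by ring

lemma prod_sum_majorant_factor_le {C ρ : ℝ} (hC : 0 ≤ C) (hρ : 0 ≤ ρ) (hρ1 : ρ < 1) (N M : ℕ) :
    ∏ i : Fin N, ∑ d ∈ Finset.range (M + 1),
        (ρ ^ ((i : ℕ) + 1)) ^ d * (if d = 0 then 1 else C) ≤
      Real.exp (C * (1 - ρ)⁻¹ * (ρ * (1 - ρ)⁻¹)) := by
  have h : ∀ (i : ℕ) (d : ℕ), 0 ≤ (ρ ^ (i + 1)) ^ d * (if d = 0 then 1 else C) :=
    fun i d ↦ mul_nonneg (by positivity) (by split_ifs <;> simp [hC])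
  calc _ ≤ ∏ i : Fin N, Real.exp (C * (1 - ρ)⁻¹ * ρ ^ ((i : ℕ) + 1)) :=
        Finset.prod_le_prod (fun i _ ↦ Finset.sum_nonneg fun d _ ↦ h i d)
          fun i _ ↦ sum_majorant_factor_le hC hρ hρ1 i M
    _ = Real.exp (C * (1 - ρ)⁻¹ * (ρ * ∑ i ∈ Finset.range N, ρ ^ i)) := by
        rw [← Real.exp_sum,
          Fin.sum_univ_eq_sum_range (fun i ↦ C * (1 - ρ)⁻¹ * ρ ^ (i + 1)), Finset.mul_sum,
          Finset.mul_sum]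
        simp only [pow_succ']
    _ ≤ _ := by
        have : 0 ≤ (1 - ρ)⁻¹ := inv_nonneg.2 (by linarith)
        gcongr
        rw [← tsum_geometric_of_lt_one hρ hρ1]
        exact (summable_geometric_of_lt_one hρ hρ1).sum_le_tsum _ fun _ _ ↦ by positivity

lemma summable_majorant {C ρ : ℝ} (hC : 0 ≤ C) (hρ : 0 ≤ ρ) (hρ1 : ρ < 1) :
    Summable fun f : Ptn ↦ majorant C ρ f := by
  refine summable_of_sum_le (c := Real.exp (C * (1 - ρ)⁻¹ * (ρ * (1 - ρ)⁻¹)))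
    (majorant_nonneg hC hρ) fun S ↦ ?_
  obtain ⟨N, hN⟩ : ∃ N, ∀ f ∈ S, ∀ i, N ≤ i → f i = 0 := by
    choose n hn using fun f : Ptn ↦ f.2.2
    exact ⟨S.sup n, fun f hf i hi ↦ hn f i ((Finset.le_sup hf).trans hi)⟩
  obtain ⟨M, hM⟩ : ∃ M, ∀ f ∈ S, f 0 ≤ M := ⟨S.sup fun f ↦ f 0, fun f hf ↦
    Finset.le_sup (f := fun f : Ptn ↦ f 0) hf⟩
  obtain ⟨φ, hφ⟩ : ∃ φ : Ptn → Fin N → ℕ, ∀ f i, φ f i = f i - f (i + 1) := ⟨_, fun _ _ ↦ rfl⟩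
  obtain ⟨F, hF⟩ : ∃ F : (Fin N → ℕ) → ℝ, ∀ d, F d =
    ∏ i : Fin N, (ρ ^ ((i : ℕ) + 1)) ^ d i * if d i = 0 then 1 else C := ⟨_, fun _ ↦ rfl⟩
  have hF0 : ∀ d, 0 ≤ F d := fun d ↦ by
    rw [hF]
    exact Finset.prod_nonneg fun i _ ↦ mul_nonneg (by positivity) (by split_ifs <;> simp [hC])
  calc ∑ f ∈ S, majorant C ρ f = ∑ f ∈ S, F (φ f) :=
        Finset.sum_congr rfl fun f hf ↦ by
          simp only [majorant_eq_prod_sub (hN f hf), hF, hφ]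
    _ = ∑ d ∈ S.image φ, F d := by
        rw [Finset.sum_image]
        intro f hf g hg h
        exact ext_of_sub (hN f hf) (hN g hg) fun i hi ↦ by
          simpa only [hφ] using congrFun h ⟨i, hi⟩
    _ ≤ ∑ d ∈ Fintype.piFinset fun _ : Fin N ↦ Finset.range (M + 1), F d := by
        refine Finset.sum_le_sum_of_subset_of_nonneg (fun d hd ↦ ?_) fun d _ _ ↦ hF0 d
        obtain ⟨f, hf, rfl⟩ := Finset.mem_image.1 hd
        simp only [Fintype.mem_piFinset, Finset.mem_range, hφ]
        intro i
        have h1 := hM f hf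
        have h2 := f.2.1 0 i (Nat.zero_le _)
        omega
    _ = ∏ i : Fin N, ∑ d ∈ Finset.range (M + 1),
          (ρ ^ ((i : ℕ) + 1)) ^ d * (if d = 0 then 1 else C) := by
        rw [Finset.prod_univ_sum]
        simp only [hF]
    _ ≤ _ := prod_sum_majorant_factor_le hC hρ hρ1 N M

end Ptn

/-- The contribution of the `i`-th parts to the weight of a pair of partitions. -/
def pairFactor (q z : ℂ) (a b : ℕ) (f g : ℕ → ℕ) (i : ℕ) : ℂ :=
  z ^ (f i + g i) *
    q ^ ((f i : ℤ) ^ 2 - (f i : ℤ) * (g i : ℤ) + (g i : ℤ) ^ 2 -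
      (if i + 1 ≤ a then (f i : ℤ) else 0) - (if i + 1 ≤ b then (g i : ℤ) else 0)) *
    (qPoch q q (f i - f (i + 1)))⁻¹ * (qPoch q q (g i - g (i + 1)))⁻¹

/-- The weight of a pair of partitions. -/
def pairWeight (q z : ℂ) (a b : ℕ) (f g : ℕ → ℕ) : ℂ := ∏' i, pairFactor q z a b f g i

lemma pairFactor_eq_one {q z : ℂ} {a b : ℕ} {f g : ℕ → ℕ} {i : ℕ} (hf : f i = 0) (hg : g i = 0) :
    pairFactor q z a b f g i = 1 := by
  simp [pairFactor, hf, hg, qPoch_zero]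

lemma pairWeight_eq_prod {q z : ℂ} {a b : ℕ} {f g : ℕ → ℕ} {N : ℕ}
    (hf : ∀ i, N ≤ i → f i = 0) (hg : ∀ i, N ≤ i → g i = 0) :
    pairWeight q z a b f g = ∏ i ∈ Finset.range N, pairFactor q z a b f g i :=
  tprod_eq_prod fun i hi ↦ by
    have hi : N ≤ i := by simpa using hi
    exact pairFactor_eq_one (hf i hi) (hg i hi)

lemma Ptn.exists_bound (f g : Ptn) (n : ℕ) :
    ∃ N, n ≤ N ∧ (∀ i, N ≤ i → f i = 0) ∧ ∀ i, N ≤ i → g i = 0 := by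
  obtain ⟨N₁, h₁⟩ := f.2.2
  obtain ⟨N₂, h₂⟩ := g.2.2
  exact ⟨max n (max N₁ N₂), le_max_left _ _,
    fun i hi ↦ h₁ i (by omega), fun i hi ↦ h₂ i (by omega)⟩

lemma pairFactor_swap (q z : ℂ) (a b : ℕ) (f g : ℕ → ℕ) (i : ℕ) :
    pairFactor q z a b f g i = pairFactor q z b a g f i := by
  unfold pairFactor
  rw [mul_right_comm, add_comm (f i)]
  congr 4
  ring

lemma pairWeight_swap (q z : ℂ) (a b : ℕ) (f g : ℕ → ℕ) :
    pairWeight q z a b f g = pairWeight q z b a g f := by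
  simp only [pairWeight, pairFactor_swap q z a b]

lemma pairFactor_succ (q z : ℂ) (a b : ℕ) (f g : ℕ → ℕ) (i : ℕ) :
    pairFactor q z a b f g (i + 1) =
      pairFactor q z (a - 1) (b - 1) (fun j ↦ f (j + 1)) (fun j ↦ g (j + 1)) i := by
  have h : ∀ c : ℕ, i + 1 ≤ c - 1 ↔ i + 1 + 1 ≤ c := by omega
  simp only [pairFactor, h]

lemma pairWeight_eq_mul (q z : ℂ) (a b : ℕ) (f g : Ptn) :
    pairWeight q z a b f g = pairFactor q z a b f g 0 *
      pairWeight q z (a - 1) (b - 1) (fun j ↦ f (j + 1)) (fun j ↦ g (j + 1)) := by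
  obtain ⟨N, -, hf, hg⟩ := f.exists_bound g 0
  rw [pairWeight_eq_prod (N := N + 1) (fun i hi ↦ hf i (by omega)) (fun i hi ↦ hg i (by omega)),
    pairWeight_eq_prod (N := N) (fun i hi ↦ hf _ (by omega)) (fun i hi ↦ hg _ (by omega)),
    Finset.prod_range_succ', mul_comm]
  simp only [pairFactor_succ]

lemma pairWeight_zero (q z : ℂ) (a b : ℕ) {f g : ℕ → ℕ} (hf : ∀ i, f i = 0) (hg : ∀ i, g i = 0) :
    pairWeight q z a b f g = 1 := by
  rw [pairWeight_eq_prod (N := 0) (fun i _ ↦ hf i) (fun i _ ↦ hg i), Finset.prod_range_zero]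

/-- Lowering both cut-offs by one multiplies the weight by a power of `q`. -/
lemma zpow_mul_pairWeight {q : ℂ} (hq0 : q ≠ 0) (z : ℂ) (a b : ℕ) (f g : Ptn) :
    q ^ ((f a : ℤ) + (g b : ℤ)) * pairWeight q z (a + 1) (b + 1) f g =
      pairWeight q z a b f g := by
  obtain ⟨N, hN, hf, hg⟩ := f.exists_bound g (max (a + 1) (b + 1))
  have ha : ∏ i ∈ Finset.range N, (if i = a then q ^ (f a : ℤ) else 1) = q ^ (f a : ℤ) := by
    rw [Finset.prod_ite_eq', if_pos (by simp; omega)]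
  have hb : ∏ i ∈ Finset.range N, (if i = b then q ^ (g b : ℤ) else 1) = q ^ (g b : ℤ) := by
    rw [Finset.prod_ite_eq', if_pos (by simp; omega)]
  rw [zpow_add₀ hq0, ← ha, ← hb, pairWeight_eq_prod hf hg, pairWeight_eq_prod hf hg,
    ← Finset.prod_mul_distrib, ← Finset.prod_mul_distrib]
  refine Finset.prod_congr rfl fun i _ ↦ ?_
  have e1 : (if i = a then q ^ (f a : ℤ) else 1) = q ^ (if i = a then (f i : ℤ) else 0) := by
    split_ifs with h
    · rw [h]
    · rw [zpow_zero]
  have e2 : (if i = b then q ^ (g b : ℤ) else 1) = q ^ (if i = b then (g i : ℤ) else 0) := by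
    split_ifs with h
    · rw [h]
    · rw [zpow_zero]
  rw [e1, e2, ← zpow_add₀ hq0]
  unfold pairFactor
  have e3 : (f i : ℤ) ^ 2 - (f i : ℤ) * (g i : ℤ) + (g i : ℤ) ^ 2 -
      (if i + 1 ≤ a then (f i : ℤ) else 0) - (if i + 1 ≤ b then (g i : ℤ) else 0) =
      (if i = a then (f i : ℤ) else 0) + (if i = b then (g i : ℤ) else 0) +
      ((f i : ℤ) ^ 2 - (f i : ℤ) * (g i : ℤ) + (g i : ℤ) ^ 2 -
      (if i + 1 ≤ a + 1 then (f i : ℤ) else 0) - (if i + 1 ≤ b + 1 then (g i : ℤ) else 0)) := by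
    split_ifs <;> omega
  rw [e3, zpow_add₀ hq0 ((if i = a then (f i : ℤ) else 0) + _)]
  ring

lemma continuous_pairWeight (q : ℂ) (a b : ℕ) (f g : Ptn) :
    Continuous fun z ↦ pairWeight q z a b f g := by
  obtain ⟨N, -, hf, hg⟩ := f.exists_bound g 0
  simp only [pairWeight_eq_prod hf hg, pairFactor]
  fun_prop

lemma exists_norm_inv_qPoch_le {q : ℂ} (hq : ‖q‖ < 1) :
    ∃ C : ℝ, 1 ≤ C ∧ ∀ n, ‖(qPoch q q n)⁻¹‖ ≤ C := by
  have hQ := qPochInf_self_ne_zero hq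
  obtain ⟨C, hC⟩ := ((tendsto_qPoch hq q).inv₀ hQ).norm.bddAbove_range
  exact ⟨max C 1, le_max_right _ _, fun n ↦ le_max_of_le_left (hC ⟨n, rfl⟩)⟩

lemma norm_inv_qPoch_le_ite {q : ℂ} {C : ℝ} (hC : ∀ n, ‖(qPoch q q n)⁻¹‖ ≤ C) (d : ℕ) :
    ‖(qPoch q q d)⁻¹‖ ≤ if d = 0 then 1 else C := by
  split_ifs with h
  · simp [h, qPoch_zero]
  · exact hC d

lemma norm_zpow_le_of_neg_one_le {q : ℂ} (hq : ‖q‖ < 1) (hq0 : q ≠ 0) {n : ℤ} (hn : -1 ≤ n) :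
    ‖q ^ n‖ ≤ ‖q‖⁻¹ := by
  rw [norm_zpow, ← zpow_neg_one]
  exact zpow_le_zpow_right_of_le_one₀ (norm_pos_iff.2 hq0) hq.le hn

lemma norm_pairFactor_le {q z : ℂ} (hq : ‖q‖ < 1) (hq0 : q ≠ 0) {C ρ : ℝ} (hC1 : 1 ≤ C)
    (hC : ∀ n, ‖(qPoch q q n)⁻¹‖ ≤ C) (hz : ‖z‖ ≤ ρ) (a b : ℕ) (f g : ℕ → ℕ) (i : ℕ) :
    ‖pairFactor q z a b f g i‖ ≤ (if i < a + b then ‖q‖⁻¹ else 1) *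
      ((ρ ^ f i * if f i - f (i + 1) = 0 then 1 else C) *
        (ρ ^ g i * if g i - g (i + 1) = 0 then 1 else C)) := by
  have h0 : (0 : ℤ) ≤ f i := Int.natCast_nonneg _
  have h0' : (0 : ℤ) ≤ g i := Int.natCast_nonneg _
  have hρ : 0 ≤ ρ := (norm_nonneg z).trans hz
  have hz' : ‖z ^ (f i + g i)‖ ≤ ρ ^ f i * ρ ^ g i := by
    rw [norm_pow, ← pow_add]
    exact pow_le_pow_left₀ (norm_nonneg _) hz _
  have hq' : ‖q ^ ((f i : ℤ) ^ 2 - (f i : ℤ) * (g i : ℤ) + (g i : ℤ) ^ 2 -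
      (if i + 1 ≤ a then (f i : ℤ) else 0) - (if i + 1 ≤ b then (g i : ℤ) else 0))‖ ≤
      if i < a + b then ‖q‖⁻¹ else 1 := by
    split_ifs with h1 h2 h3 h3 h2 h3 h3
    all_goals first | (exfalso; omega) | refine norm_zpow_le_of_neg_one_le hq hq0 ?_ | skip
    any_goals nlinarith [sq_nonneg ((f i : ℤ) - g i), sq_nonneg ((f i : ℤ) - 1),
      sq_nonneg ((g i : ℤ) - 1)]
    have h : (0 : ℤ) ≤ (f i : ℤ) ^ 2 - (f i : ℤ) * (g i : ℤ) + (g i : ℤ) ^ 2 - 0 - 0 := by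
      nlinarith [sq_nonneg ((f i : ℤ) - g i)]
    rw [norm_zpow, ← zpow_zero ‖q‖]
    exact zpow_le_zpow_right_of_le_one₀ (norm_pos_iff.2 hq0) hq.le h
  have h1 := norm_inv_qPoch_le_ite hC (f i - f (i + 1))
  have h2 := norm_inv_qPoch_le_ite hC (g i - g (i + 1))
  unfold pairFactor
  rw [norm_mul, norm_mul, norm_mul]
  calc _ ≤ ρ ^ f i * ρ ^ g i * (if i < a + b then ‖q‖⁻¹ else 1) *
        (if f i - f (i + 1) = 0 then 1 else C) * (if g i - g (i + 1) = 0 then 1 else C) := by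
        gcongr
    _ = _ := by ring

lemma norm_pairWeight_le {q z : ℂ} (hq : ‖q‖ < 1) (hq0 : q ≠ 0) {C ρ : ℝ} (hC1 : 1 ≤ C)
    (hC : ∀ n, ‖(qPoch q q n)⁻¹‖ ≤ C) (hz : ‖z‖ ≤ ρ) (a b : ℕ) (f g : Ptn) :
    ‖pairWeight q z a b f g‖ ≤
      ‖q‖⁻¹ ^ (a + b) * (Ptn.majorant C ρ f * Ptn.majorant C ρ g) := by
  obtain ⟨N, hN, hf, hg⟩ := f.exists_bound g (a + b)
  rw [pairWeight_eq_prod hf hg, Ptn.majorant_eq_prod hf, Ptn.majorant_eq_prod hg, norm_prod]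
  refine (Finset.prod_le_prod (fun i _ ↦ norm_nonneg _)
    fun i _ ↦ norm_pairFactor_le hq hq0 hC1 hC hz a b f g i).trans_eq ?_
  rw [Finset.prod_mul_distrib, Finset.prod_mul_distrib]
  congr 1
  rw [Finset.prod_ite, Finset.prod_const_one, mul_one, Finset.prod_const]
  congr 1
  rw [show Finset.filter (fun i ↦ i < a + b) (Finset.range N) = Finset.range (a + b) by
    ext i; simp; omega, Finset.card_range]

lemma summable_pairWeight {q z : ℂ} (hq : ‖q‖ < 1) (hq0 : q ≠ 0) (hz : ‖z‖ < 1) (a b : ℕ) :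
    Summable fun p : Ptn × Ptn ↦ pairWeight q z a b p.1 p.2 := by
  obtain ⟨C, hC1, hC⟩ := exists_norm_inv_qPoch_le hq
  have hC0 : 0 ≤ C := zero_le_one.trans hC1
  have h := Ptn.summable_majorant hC0 (norm_nonneg z) hz
  refine Summable.of_norm_bounded ((h.mul_of_nonneg h (Ptn.majorant_nonneg hC0 (norm_nonneg z))
    (Ptn.majorant_nonneg hC0 (norm_nonneg z))).mul_left (‖q‖⁻¹ ^ (a + b))) fun p ↦ ?_
  exact norm_pairWeight_le hq hq0 hC1 hC le_rfl a b p.1 p.2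

lemma continuousAt_tsum_pairWeight {q z : ℂ} (hq : ‖q‖ < 1) (hq0 : q ≠ 0) (hz : ‖z‖ < 1)
    (a b : ℕ) : ContinuousAt (fun w ↦ ∑' p : Ptn × Ptn, pairWeight q w a b p.1 p.2) z := by
  obtain ⟨ρ, hρz, hρ1⟩ := exists_between hz
  have hρ : 0 ≤ ρ := (norm_nonneg z).trans hρz.le
  obtain ⟨C, hC1, hC⟩ := exists_norm_inv_qPoch_le hq
  have hC0 : 0 ≤ C := zero_le_one.trans hC1
  have h := Ptn.summable_majorant hC0 hρ hρ1
  have hcont : ContinuousOn (fun w ↦ ∑' p : Ptn × Ptn, pairWeight q w a b p.1 p.2)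
      (Metric.ball 0 ρ) :=
    continuousOn_tsum (fun p ↦ (continuous_pairWeight q a b p.1 p.2).continuousOn)
      ((h.mul_of_nonneg h (Ptn.majorant_nonneg hC0 hρ)
        (Ptn.majorant_nonneg hC0 hρ)).mul_left (‖q‖⁻¹ ^ (a + b)))
      fun p w hw ↦ norm_pairWeight_le hq hq0 hC1 hC (mem_ball_zero_iff.1 hw).le a b p.1 p.2
  exact hcont.continuousAt (Metric.isOpen_ball.mem_nhds (by simpa using hρz))

lemma norm_invPoch_le {q : ℂ} {C : ℝ} (hC1 : 1 ≤ C) (hC : ∀ n, ‖(qPoch q q n)⁻¹‖ ≤ C)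
    (n k : ℕ) : ‖invPoch q n k‖ ≤ C := by
  unfold invPoch
  split_ifs
  · exact hC _
  · simpa using zero_le_one.trans hC1

/-- The sum over pairs of partitions truncated by the sizes of the largest parts. -/
def pairSum (q z : ℂ) (a b L M : ℕ) : ℂ :=
  ∑' p : Ptn × Ptn, invPoch q L (p.1 0) * invPoch q M (p.2 0) * pairWeight q z a b p.1 p.2

lemma norm_pairSum_term_le {q z : ℂ} {C : ℝ} (hC1 : 1 ≤ C)
    (hC : ∀ n, ‖(qPoch q q n)⁻¹‖ ≤ C) (a b L M : ℕ) (p : Ptn × Ptn) :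
    ‖invPoch q L (p.1 0) * invPoch q M (p.2 0) * pairWeight q z a b p.1 p.2‖ ≤
      C * C * ‖pairWeight q z a b p.1 p.2‖ := by
  rw [norm_mul, norm_mul]
  have h1 := norm_invPoch_le hC1 hC L (p.1 0)
  have h2 := norm_invPoch_le hC1 hC M (p.2 0)
  gcongr

lemma summable_pairSum {q z : ℂ} (hq : ‖q‖ < 1) (hq0 : q ≠ 0) (hz : ‖z‖ < 1) (a b L M : ℕ) :
    Summable fun p : Ptn × Ptn ↦
      invPoch q L (p.1 0) * invPoch q M (p.2 0) * pairWeight q z a b p.1 p.2 := by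
  obtain ⟨C, hC1, hC⟩ := exists_norm_inv_qPoch_le hq
  exact Summable.of_norm_bounded ((summable_pairWeight hq hq0 hz a b).norm.mul_left (C * C))
    (norm_pairSum_term_le hC1 hC a b L M)

lemma tendsto_invPoch {q : ℂ} (hq : ‖q‖ < 1) (k : ℕ) :
    Tendsto (fun n ↦ invPoch q n k) atTop (𝓝 (qPochInf q q)⁻¹) := by
  have hQ := qPochInf_self_ne_zero hq
  refine (((tendsto_qPoch hq q).inv₀ hQ).comp (tendsto_sub_atTop_nat k)).congr' ?_
  filter_upwards [eventually_ge_atTop k] with n hn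
  rw [Function.comp_apply, invPoch_of_le hn]

lemma tendsto_pairSum {q z : ℂ} (hq : ‖q‖ < 1) (hq0 : q ≠ 0) (hz : ‖z‖ < 1) (a b : ℕ) :
    Tendsto (fun x : ℕ × ℕ ↦ pairSum q z a b x.1 x.2) atTop
      (𝓝 ((qPochInf q q ^ 2)⁻¹ * ∑' p : Ptn × Ptn, pairWeight q z a b p.1 p.2)) := by
  obtain ⟨C, hC1, hC⟩ := exists_norm_inv_qPoch_le hq
  rw [← tsum_mul_left]
  refine tendsto_tsum_of_dominated_convergence
    ((summable_pairWeight hq hq0 hz a b).norm.mul_left (C * C)) (fun p ↦ ?_)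
    (Eventually.of_forall fun x ↦ norm_pairSum_term_le hC1 hC a b x.1 x.2)
  rw [sq, mul_inv, ← prod_atTop_atTop_eq]
  exact (((tendsto_invPoch hq _).comp tendsto_fst).mul
    ((tendsto_invPoch hq _).comp tendsto_snd)).mul_const _

namespace Ptn

/-- The partition with its largest part removed. -/
def tail (f : Ptn) : Ptn :=
  ⟨fun i ↦ f (i + 1), fun _ _ h ↦ f.2.1 _ _ (Nat.succ_le_succ h),
    f.2.2.imp fun _ hN _ hi ↦ hN _ (hi.trans (Nat.le_succ _))⟩

/-- The partition with a new largest part. -/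
def cons (r : ℕ) (f : Ptn) (h : f 0 ≤ r) : Ptn :=
  ⟨fun i ↦ i.casesOn r f, fun i j hij ↦ by
    cases i with
    | zero =>
      cases j with
      | zero => exact le_rfl
      | succ j => exact (f.2.1 0 j (Nat.zero_le _)).trans h
    | succ i =>
      cases j with
      | zero => omega
      | succ j => exact f.2.1 i j (Nat.le_of_succ_le_succ hij),
    f.2.2.imp' Nat.succ fun N hN i hi ↦ by
      cases i with
      | zero => omega
      | succ i => exact hN i (Nat.le_of_succ_le_succ hi)⟩

lemma tail_cons (r : ℕ) (f : Ptn) (h : f 0 ≤ r) : (cons r f h).tail = f := rfl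

lemma ext_of_tail {f g : Ptn} (h0 : f 0 = g 0) (h : f.tail = g.tail) : f = g := by
  refine Subtype.ext (funext fun i ↦ ?_)
  cases i with
  | zero => exact h0
  | succ i => exact congrFun (congrArg Subtype.val h) i

end Ptn

lemma pairFactor_zero_eq {q : ℂ} (hq0 : q ≠ 0) (z : ℂ) (a b : ℕ) (f g : Ptn) :
    pairFactor q z a b f g 0 =
      (if 1 ≤ a then z * q⁻¹ else z) ^ f 0 * (if 1 ≤ b then z * q⁻¹ else z) ^ g 0 *
        q ^ ((f 0 : ℤ) ^ 2 - (f 0 : ℤ) * (g 0 : ℤ) + (g 0 : ℤ) ^ 2) *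
        (invPoch q (f 0) (f 1) * invPoch q (g 0) (g 1)) := by
  have hw : ∀ c r : ℕ, (if 1 ≤ c then z * q⁻¹ else z) ^ r =
      z ^ r * (q ^ (if 1 ≤ c then (r : ℤ) else 0))⁻¹ := fun c r ↦ by
    split_ifs
    · rw [mul_pow, zpow_natCast, inv_pow]
    · simp
  rw [pairFactor, hw, hw, zero_add, zpow_sub₀ hq0, zpow_sub₀ hq0, pow_add,
    invPoch_of_le (f.succ_le 0), invPoch_of_le (g.succ_le 0)]
  ring

/-- Removing the largest parts exhibits the truncated sum as the image of a Bailey operator. -/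
lemma pairSum_eq_baileyOp {q z : ℂ} (hq : ‖q‖ < 1) (hq0 : q ≠ 0) (hz : ‖z‖ < 1) (a b : ℕ) :
    pairSum q z a b =
      baileyOp q (if 1 ≤ a then z * q⁻¹ else z) (if 1 ≤ b then z * q⁻¹ else z)
        (pairSum q z (a - 1) (b - 1)) := by
  funext L M
  set x := if 1 ≤ a then z * q⁻¹ else z with hx
  set y := if 1 ≤ b then z * q⁻¹ else z with hy
  obtain ⟨E, hE⟩ : ∃ E : Ptn × Ptn → (ℕ × ℕ) × (Ptn × Ptn),
      ∀ p, E p = ((p.1 0, p.2 0), (p.1.tail, p.2.tail)) := ⟨_, fun _ ↦ rfl⟩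
  obtain ⟨F, hF⟩ : ∃ F : (ℕ × ℕ) × (Ptn × Ptn) → ℂ, ∀ u, F u =
      invPoch q L u.1.1 * invPoch q M u.1.2 * (x ^ u.1.1 * y ^ u.1.2 *
        q ^ ((u.1.1 : ℤ) ^ 2 - (u.1.1 : ℤ) * (u.1.2 : ℤ) + (u.1.2 : ℤ) ^ 2)) *
      (invPoch q u.1.1 (u.2.1 0) * invPoch q u.1.2 (u.2.2 0) *
        pairWeight q z (a - 1) (b - 1) u.2.1 u.2.2) := ⟨_, fun _ ↦ rfl⟩
  have hEinj : Function.Injective E := fun p p' h ↦ by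
    simp only [hE, Prod.mk.injEq] at h
    exact Prod.ext (Ptn.ext_of_tail h.1.1 h.2.1) (Ptn.ext_of_tail h.1.2 h.2.2)
  have hsupp : Function.support F ⊆ Set.range E := by
    rintro ⟨⟨r, s⟩, f, g⟩ hu
    rw [Function.mem_support, hF] at hu
    have h1 : f 0 ≤ r := by
      by_contra! h
      exact hu (by simp [invPoch_of_lt h])
    have h2 : g 0 ≤ s := by
      by_contra! h
      exact hu (by simp [invPoch_of_lt h])
    exact ⟨(f.cons r h1, g.cons s h2), by simp only [hE, Ptn.tail_cons]; rfl⟩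
  have hFE : ∀ p : Ptn × Ptn, F (E p) =
      invPoch q L (p.1 0) * invPoch q M (p.2 0) * pairWeight q z a b p.1 p.2 := by
    rintro ⟨f, g⟩
    rw [hF, hE, pairWeight_eq_mul q z a b f g, pairFactor_zero_eq hq0]
    change invPoch q L (f 0) * invPoch q M (g 0) * (x ^ f 0 * y ^ g 0 *
        q ^ ((f 0 : ℤ) ^ 2 - (f 0 : ℤ) * (g 0 : ℤ) + (g 0 : ℤ) ^ 2)) *
      (invPoch q (f 0) (f 1) * invPoch q (g 0) (g 1) * pairWeight q z (a - 1) (b - 1)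
        (fun j ↦ f (j + 1)) (fun j ↦ g (j + 1))) = _
    ring
  have hFs : Summable F := by
    rw [← hEinj.summable_iff fun u hu ↦ by
      by_contra h
      exact hu (hsupp h)]
    exact (summable_pairSum hq hq0 hz a b L M).congr fun p ↦ (hFE p).symm
  calc pairSum q z a b L M = ∑' p, F (E p) := by simp only [pairSum, hFE]
    _ = ∑' u, F u := hEinj.tsum_eq hsupp
    _ = ∑' rs : ℕ × ℕ, ∑' fg : Ptn × Ptn, F (rs, fg) := hFs.tsum_prod
    _ = ∑ rs ∈ Finset.range (L + 1) ×ˢ Finset.range (M + 1), ∑' fg : Ptn × Ptn, F (rs, fg) := by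
      refine tsum_eq_sum fun rs hrs ↦ ?_
      simp only [Finset.mem_product, Finset.mem_range, not_and_or, not_lt] at hrs
      simp only [hF]
      rcases hrs with h | h
      · simp [invPoch_of_lt (Nat.lt_of_succ_le h)]
      · simp [invPoch_of_lt (Nat.lt_of_succ_le h)]
    _ = _ := by
      simp only [Finset.sum_product, hF, tsum_mul_left, baileyOp, pairSum]

lemma eq_of_baileyOp_eq_self {q z : ℂ} (hq : ‖q‖ < 1) (hq0 : q ≠ 0) (hz : ‖z‖ < 1)
    {f g : ℕ → ℕ → ℂ} (hf : baileyOp q z z f = f) (hg : baileyOp q z z g = g)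
    (h0 : f 0 0 = g 0 0) : f = g := by
  suffices h : ∀ n L M, L + M = n → f L M = g L M from funext₂ fun L M ↦ h _ L M rfl
  intro n
  induction n using Nat.strong_induction_on with
  | _ n ih =>
    intro L M hLM
    rcases Nat.eq_zero_or_pos n with rfl | hn
    · obtain ⟨rfl, rfl⟩ : L = 0 ∧ M = 0 := by omega
      exact h0
    obtain ⟨c, hc⟩ : ∃ c : ℂ, c = z ^ L * z ^ M *
      q ^ ((L : ℤ) ^ 2 - (L : ℤ) * (M : ℤ) + (M : ℤ) ^ 2) := ⟨_, rfl⟩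
    have hdiff : f L M - g L M = c * (f L M - g L M) := by
      have e : f L M - g L M = baileyOp q z z f L M - baileyOp q z z g L M := by rw [hf, hg]
      refine e.trans ?_
      simp only [baileyOp, ← Finset.sum_sub_distrib, ← mul_sub]
      rw [Finset.sum_eq_single L, Finset.sum_eq_single M, invPoch_self, invPoch_self, hc]
      · ring
      · intro s hs hsM
        have hs := Finset.mem_range.1 hs
        rw [ih (L + s) (by omega) L s rfl, sub_self, mul_zero]
      · simp
      · intro r hr hrL
        have hr := Finset.mem_range.1 hr
        refine Finset.sum_eq_zero fun s hs ↦ ?_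
        have hs := Finset.mem_range.1 hs
        rw [ih (r + s) (by omega) r s rfl, sub_self, mul_zero]
      · simp
    have hnorm : ‖c‖ < 1 := by
      have h2 : (0 : ℤ) ≤ (L : ℤ) ^ 2 - (L : ℤ) * (M : ℤ) + (M : ℤ) ^ 2 := by
        nlinarith [sq_nonneg ((L : ℤ) - M), sq_nonneg ((L : ℤ) + M)]
      have h3 : ‖q ^ ((L : ℤ) ^ 2 - (L : ℤ) * (M : ℤ) + (M : ℤ) ^ 2)‖ ≤ 1 := by
        rw [norm_zpow, ← zpow_zero ‖q‖]
        exact zpow_le_zpow_right_of_le_one₀ (norm_pos_iff.2 hq0) hq.le h2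
      rw [hc, ← pow_add, hLM, norm_mul, norm_pow]
      exact mul_lt_one_of_nonneg_of_lt_one_left (by positivity)
        (pow_lt_one₀ (norm_nonneg _) hz hn.ne') h3
    have h1 : (1 - c) * (f L M - g L M) = 0 := by rw [sub_mul, one_mul, ← hdiff, sub_self]
    exact sub_eq_zero.1 ((mul_eq_zero.1 h1).resolve_left (one_sub_ne_zero_of_norm_lt hnorm))

lemma pairSum_zero_zero_zero_zero (q z : ℂ) : pairSum q z 0 0 0 0 = 1 := by
  obtain ⟨o, ho⟩ : ∃ o : Ptn, ∀ i, o i = 0 :=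
    ⟨⟨fun _ ↦ 0, fun _ _ _ ↦ le_rfl, 0, fun _ _ ↦ rfl⟩, fun _ ↦ rfl⟩
  have hz : ∀ f : Ptn, f 0 = 0 → f = o := fun f hf ↦ Subtype.ext (funext fun i ↦ by
    have := f.2.1 0 i (Nat.zero_le _)
    rw [ho]
    omega)
  rw [pairSum, tsum_eq_single (o, o)]
  · rw [pairWeight_zero q z 0 0 ho ho, ho, invPoch_self]
    ring
  · rintro ⟨f, g⟩ h
    by_cases h1 : f 0 = 0
    · by_cases h2 : g 0 = 0
      · exact absurd (by rw [hz f h1, hz g h2]) h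
      · simp [invPoch_of_lt (Nat.pos_of_ne_zero h2)]
    · simp [invPoch_of_lt (Nat.pos_of_ne_zero h1)]

lemma pairSum_zero_zero {q z : ℂ} (hq : ‖q‖ < 1) (hq0 : q ≠ 0) (hz : ‖z‖ < 1) :
    pairSum q z 0 0 = baileyFix q z z := by
  refine eq_of_baileyOp_eq_self hq hq0 hz ?_ ?_ ?_
  · simpa using (pairSum_eq_baileyOp hq hq0 hz 0 0).symm
  · refine baileyOp_baileyFix hq hq0 (fun n ↦ one_sub_mul_pow_ne_zero hq hz _)
      (fun n ↦ one_sub_mul_pow_ne_zero hq hz _) fun n ↦ ?_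
    rw [← sq]
    exact one_sub_mul_pow_ne_zero hq (norm_sq_lt_one hz) _
  · rw [pairSum_zero_zero_zero_zero]
    simp [baileyFix, qPoch_zero]

lemma pairSum_zero_left {q z : ℂ} (hq : ‖q‖ < 1) (hq0 : q ≠ 0) (hz : ‖z‖ < 1) (n : ℕ) :
    pairSum q z 0 n = (baileyOp q z (z * q⁻¹))^[n] (baileyFix q z z) := by
  induction n with
  | zero => exact pairSum_zero_zero hq hq0 hz
  | succ n ih => simp [pairSum_eq_baileyOp hq hq0 hz 0 (n + 1), ih, Function.iterate_succ_apply']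

lemma pairSum_self_add {q z : ℂ} (hq : ‖q‖ < 1) (hq0 : q ≠ 0) (hz : ‖z‖ < 1) (n a : ℕ) :
    pairSum q z a (a + n) = (baileyOp q (z * q⁻¹) (z * q⁻¹))^[a]
      ((baileyOp q z (z * q⁻¹))^[n] (baileyFix q z z)) := by
  induction a with
  | zero => rw [zero_add, pairSum_zero_left hq hq0 hz, Function.iterate_zero_apply]
  | succ a ih =>
    rw [pairSum_eq_baileyOp hq hq0 hz, Function.iterate_succ_apply', ← ih, if_pos (by omega),
      if_pos (by omega), Nat.add_sub_cancel, add_right_comm, Nat.add_sub_cancel]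

/-! ### The specialised identity -/

/-- The product side of the specialised identity. -/
def huaProd (q z : ℂ) (a b : ℕ) : ℂ :=
  1 / (qPochInf (z * q) q * qPochInf (z * q) q * qPochInf (z ^ 2 * q) q) *
    ((1 - z ^ (a + 1)) * (1 - z ^ (b + 1)) * (1 - z ^ (a + b + 2)) /
      ((1 - z) * (1 - z) * (1 - z ^ 2)))

lemma huaProd_swap (q z : ℂ) (a b : ℕ) : huaProd q z a b = huaProd q z b a := by
  simp only [huaProd, add_comm a b, mul_comm (1 - z ^ (a + 1))]

lemma qPochInf_self_sq_ne_zero {q : ℂ} (hq : ‖q‖ < 1) : (qPochInf q q ^ 2)⁻¹ ≠ 0 :=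
  inv_ne_zero (pow_ne_zero 2 (qPochInf_self_ne_zero hq))

lemma tsum_pairWeight_zero_left {q z : ℂ} (hq : ‖q‖ < 1) (hq0 : q ≠ 0) (hz : ‖z‖ < 1) (b : ℕ) :
    ∑' p : Ptn × Ptn, pairWeight q z 0 b p.1 p.2 = huaProd q z 0 b := by
  have h := tendsto_pairSum hq hq0 hz 0 b
  rw [pairSum_zero_left hq hq0 hz] at h
  have := mul_left_cancel₀ (qPochInf_self_sq_ne_zero hq)
    (tendsto_nhds_unique h (tendsto_iterate_baileyFix hq hq0 hz b))
  simpa [huaProd] using this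

lemma tsum_pairWeight_succ_sub {q z : ℂ} (hq : ‖q‖ < 1) (hq0 : q ≠ 0) (hz : ‖z‖ < 1)
    (h1 : z ≠ q) (h2 : z ^ 2 ≠ q) (n a : ℕ) :
    ∑' p : Ptn × Ptn, pairWeight q z (a + 1) (a + n + 1) p.1 p.2 -
      z ^ 2 * q⁻¹ * ∑' p : Ptn × Ptn, pairWeight q z a (a + n) p.1 p.2 =
      huaProd q z (a + 1) (a + n + 1) := by
  obtain ⟨l, hl, hrec⟩ := exists_limit_iterate_iterate_baileyFix hq hq0 hz h1 h2 n
  have hla : ∀ a, l a = (qPochInf q q ^ 2)⁻¹ *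
      ∑' p : Ptn × Ptn, pairWeight q z a (a + n) p.1 p.2 := fun a ↦ by
    have h := tendsto_pairSum hq hq0 hz a (a + n)
    rw [pairSum_self_add hq hq0 hz] at h
    exact tendsto_nhds_unique (hl a) h
  have h := hrec a
  rw [hla, hla, add_right_comm a 1 n] at h
  refine mul_left_cancel₀ (qPochInf_self_sq_ne_zero hq) ?_
  rw [huaProd, show a + 1 + (a + n + 1) + 2 = 2 * a + n + 4 by ring, mul_sub]
  linear_combination h

lemma continuousAt_huaProd {q z : ℂ} (hq : ‖q‖ < 1) (hz : ‖z‖ < 1) (a b : ℕ) :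
    ContinuousAt (fun w ↦ huaProd q w a b) z := by
  have hz1 := one_sub_ne_zero_of_norm_lt hz
  have hz2 := one_sub_ne_zero_of_norm_lt (norm_sq_lt_one hz)
  have hzq : qPochInf (z * q) q ≠ 0 := qPochInf_ne_zero hq fun n ↦ by
    simpa [pow_succ', mul_assoc] using one_sub_mul_pow_ne_zero hq hz (n + 1)
  have hzq2 : qPochInf (z ^ 2 * q) q ≠ 0 := qPochInf_ne_zero hq fun n ↦ by
    simpa [pow_succ', mul_assoc] using one_sub_mul_pow_ne_zero hq (norm_sq_lt_one hz) (n + 1)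
  have c1 : Continuous fun w : ℂ ↦ qPochInf (w * q) q := (continuous_qPochInf hq).comp (by fun_prop)
  have c2 : Continuous fun w : ℂ ↦ qPochInf (w ^ 2 * q) q :=
    (continuous_qPochInf hq).comp (by fun_prop)
  unfold huaProd
  refine ContinuousAt.mul (ContinuousAt.div (by fun_prop) (by fun_prop) ?_)
    (ContinuousAt.div (by fun_prop) (by fun_prop) ?_)
  · exact mul_ne_zero (mul_ne_zero hzq hzq) hzq2
  · exact mul_ne_zero (mul_ne_zero hz1 hz1) hz2

lemma eventually_nhdsNE_generic (q z : ℂ) : ∀ᶠ w in 𝓝[≠] z, w ≠ q ∧ w ^ 2 ≠ q := by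
  have hfin : {w : ℂ | w = q ∨ w ^ 2 = q}.Finite := by
    refine ((Set.finite_singleton q).union
      ((Polynomial.nthRoots 2 q).toFinset.finite_toSet)).subset ?_
    rintro w (hw | hw)
    · exact Or.inl hw
    · exact Or.inr (by simpa [Polynomial.mem_nthRoots] using hw)
  filter_upwards [hfin.eventually_cofinite_notMem.filter_mono (nhdsNE_le_cofinite z)] with w hw
  simpa [not_or] using hw

lemma tsum_pairWeight_succ_sub_of_norm_lt {q z : ℂ} (hq : ‖q‖ < 1) (hq0 : q ≠ 0) (hz : ‖z‖ < 1)
    (n a : ℕ) :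
    ∑' p : Ptn × Ptn, pairWeight q z (a + 1) (a + n + 1) p.1 p.2 -
      z ^ 2 * q⁻¹ * ∑' p : Ptn × Ptn, pairWeight q z a (a + n) p.1 p.2 =
      huaProd q z (a + 1) (a + n + 1) := by
  have hL : ContinuousAt (fun w ↦ ∑' p : Ptn × Ptn, pairWeight q w (a + 1) (a + n + 1) p.1 p.2 -
      w ^ 2 * q⁻¹ * ∑' p : Ptn × Ptn, pairWeight q w a (a + n) p.1 p.2) z :=
    (continuousAt_tsum_pairWeight hq hq0 hz _ _).sub
      (ContinuousAt.mul (by fun_prop) (continuousAt_tsum_pairWeight hq hq0 hz _ _))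
  have hR := continuousAt_huaProd hq hz (a + 1) (a + n + 1)
  refine tendsto_nhds_unique_of_eventuallyEq (l := 𝓝[≠] z) (hL.tendsto.mono_left nhdsWithin_le_nhds)
    (hR.tendsto.mono_left nhdsWithin_le_nhds) ?_
  have hball : ∀ᶠ w in 𝓝[≠] z, ‖w‖ < 1 :=
    (continuous_norm.continuousAt.eventually_lt continuousAt_const hz).filter_mono
      nhdsWithin_le_nhds
  filter_upwards [eventually_nhdsNE_generic q z, hball] with w hw hw1
  exact tsum_pairWeight_succ_sub hq hq0 hw1 hw.1 hw.2 n a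

/-- The sum side of the specialised identity. -/
def huaSum (q z : ℂ) (a b : ℕ) : ℂ :=
  ∑' p : Ptn × Ptn, (1 - (if a = 0 ∨ b = 0 then (0 : ℂ) else
    z ^ 2 * q ^ ((p.1 (a - 1) : ℤ) + (p.2 (b - 1) : ℤ) - 1))) * pairWeight q z a b p.1 p.2

lemma huaSum_swap (q z : ℂ) (a b : ℕ) : huaSum q z a b = huaSum q z b a := by
  rw [huaSum, huaSum, ← (Equiv.prodComm Ptn Ptn).tsum_eq]
  refine tsum_congr fun p ↦ ?_
  rw [pairWeight_swap]
  simp only [Equiv.prodComm_apply, Prod.fst_swap, Prod.snd_swap, or_comm (a := a = 0),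
    add_comm (p.2 (a - 1) : ℤ)]

lemma huaSum_eq_huaProd_of_le {q z : ℂ} (hq : ‖q‖ < 1) (hq0 : q ≠ 0) (hz : ‖z‖ < 1) {a b : ℕ}
    (hab : a ≤ b) : huaSum q z a b = huaProd q z a b := by
  obtain ⟨n, rfl⟩ := Nat.exists_eq_add_of_le hab
  cases a with
  | zero => simpa [huaSum] using tsum_pairWeight_zero_left hq hq0 hz (0 + n)
  | succ a =>
    rw [add_right_comm, ← tsum_pairWeight_succ_sub_of_norm_lt hq hq0 hz n a, ← tsum_mul_left,
      ← (summable_pairWeight hq hq0 hz _ _).tsum_sub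
        ((summable_pairWeight hq hq0 hz _ _).mul_left _), huaSum]
    refine tsum_congr fun p ↦ ?_
    rw [if_neg (by omega), Nat.add_sub_cancel, Nat.add_sub_cancel, sub_mul, one_mul,
      zpow_sub_one₀ hq0,
      ← zpow_mul_pairWeight hq0 z a (a + n)]
    ring

lemma huaSum_eq_huaProd {q z : ℂ} (hq : ‖q‖ < 1) (hq0 : q ≠ 0) (hz : ‖z‖ < 1) (a b : ℕ) :
    huaSum q z a b = huaProd q z a b := by
  rcases le_total a b with h | h
  · exact huaSum_eq_huaProd_of_le hq hq0 hz h
  · rw [huaSum_swap, huaProd_swap]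
    exact huaSum_eq_huaProd_of_le hq hq0 hz h

/-- The specialisation `(x₁,x₂,x₃) = (z²,z,1)` of the Hua-type identity
(end of Section 1 of the paper; it proves Kanade–Russell's Conjecture 3.1 at
`z = q`).  In the sum, `p.1.1 i` is the part `λ_{i+1}` of the partition `λ`
(and similarly for `μ`). -/
theorem specialised_hua_identity
    (a b : ℕ) (q z : ℂ) (hq : ‖q‖ < 1) (hq0 : q ≠ 0) (hz : ‖z‖ < 1) :
    (∑' p : Ptn × Ptn,
      (1 - (if a = 0 ∨ b = 0 then (0 : ℂ) else
          z ^ 2 * q ^ ((p.1.1 (a - 1) : ℤ) + (p.2.1 (b - 1) : ℤ) - 1))) *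
        ∏' i : ℕ,
          (z ^ (p.1.1 i + p.2.1 i) *
            q ^ ((p.1.1 i : ℤ) ^ 2 - (p.1.1 i : ℤ) * (p.2.1 i : ℤ) +
                (p.2.1 i : ℤ) ^ 2 -
                (if i + 1 ≤ a then (p.1.1 i : ℤ) else 0) -
                (if i + 1 ≤ b then (p.2.1 i : ℤ) else 0)) *
            (qPoch q q (p.1.1 i - p.1.1 (i + 1)))⁻¹ *
            (qPoch q q (p.2.1 i - p.2.1 (i + 1)))⁻¹))
    = 1 / (qPochInf (z * q) q * qPochInf (z * q) q * qPochInf (z ^ 2 * q) q) *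
        ((1 - z ^ (a + 1)) * (1 - z ^ (b + 1)) * (1 - z ^ (a + b + 2)) /
          ((1 - z) * (1 - z) * (1 - z ^ 2))) := by
  exact huaSum_eq_huaProd hq hq0 hz a b

end Stmt5
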